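/- Let F be a field with at least 4 elements and v : F^× → ℤ a surjective discrete valuation with residue field k. Suppose there exists n > 0 such that U_n ⊆ U_1², where U_m := 1 + M_v^m. Then the specialization homomorphism induces an isomorphism of R_F-modules I_F·RP′(F)[1/2] ≅ I_F·(Ind_F^k RP′(k)[1/2]). -/

import Mathlib

open scoped Classical

noncomputable section

variable (F : Type) [Field F]

/-- The group of square classes `G_F = F^× / (F^×)²`. -/
def SqCl (F : Type) [Field F] : Type :=
  Fˣ ⧸ (powMonoidHom 2 : Fˣ →* Fˣ).range

instance : CommGroup (SqCl F) := QuotientGroup.Quotient.commGroup _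

/-- The square class of a unit. -/
def sqc : Fˣ →* SqCl F := QuotientGroup.mk' _

/-- The group ring `R_F = ℤ[F^×/(F^×)²]`. -/
abbrev RF (F : Type) [Field F] : Type := MonoidAlgebra ℤ (SqCl F)

/-- `⟨x⟩ ∈ R_F`, the square class of a unit as an element of the group ring. -/
def cls (x : Fˣ) : RF F := MonoidAlgebra.of ℤ (SqCl F) (sqc F x)

/-- The free `R_F`-module on the set `F^×`. -/
abbrev FreeRP (F : Type) [Field F] : Type := Fˣ →₀ RF F

/-- The generator `[x]` of the free module. -/
def gen (x : Fˣ) : FreeRP F := Finsupp.single x 1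

/-- units from nonzero field elements -/
def U (x : F) (h : x ≠ 0) : Fˣ := Units.mk0 x h

variable {F}

theorem one_sub_ne {x : Fˣ} (hx : (x : F) ≠ 1) : (1 : F) - x ≠ 0 :=
  sub_ne_zero.mpr (Ne.symm hx)

theorem inv_sub_one_ne {x : Fˣ} (hx : (x : F) ≠ 1) : ((x : F)⁻¹ - 1) ≠ 0 :=
  sub_ne_zero.mpr (fun h => hx (by rwa [inv_eq_one] at h))

theorem one_sub_inv_ne {x : Fˣ} (hx : (x : F) ≠ 1) : (1 - (x : F)⁻¹) ≠ 0 :=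
  sub_ne_zero.mpr (fun h => hx (by rw [eq_comm, inv_eq_one] at h; exact h.symm ▸ rfl))

variable (F)

/-- The five term relation `S_{x,y}` as an element of the free module. -/
def FT (x y : Fˣ) (hx : (x : F) ≠ 1) (hy : (y : F) ≠ 1) : FreeRP F :=
  gen F x - gen F y + cls F x • gen F (y * x⁻¹)
    - cls F (U F ((x : F)⁻¹ - 1) (inv_sub_one_ne hx)) •
        gen F (U F ((1 - (x : F)⁻¹) / (1 - (y : F)⁻¹))
          (div_ne_zero (one_sub_inv_ne hx) (one_sub_inv_ne hy)))
    + cls F (U F (1 - (x : F)) (one_sub_ne hx)) •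
        gen F (U F ((1 - (x : F)) / (1 - (y : F)))
          (div_ne_zero (one_sub_ne hx) (one_sub_ne hy)))

/-- The set of five-term relations. -/
def ftRels : Set (FreeRP F) :=
  {w | ∃ (x y : Fˣ) (hx : (x : F) ≠ 1) (hy : (y : F) ≠ 1), w = FT F x y hx hy}

/-- The relations `ψ₁(x) = [x] + ⟨-1⟩[x⁻¹]`. -/
def psiRels : Set (FreeRP F) :=
  {w | ∃ x : Fˣ, w = gen F x + cls F (-1) • gen F x⁻¹}

/-- relations `⟨-1⟩[x] = [x]` -/
def minusRels : Set (FreeRP F) :=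
  {w | ∃ x : Fˣ, w = cls F (-1) • gen F x - gen F x}

/-- relations `[x⁻¹] = -[x]` -/
def invRels : Set (FreeRP F) :=
  {w | ∃ x : Fˣ, w = gen F x⁻¹ + gen F x}

/-- The module `qRP(F) = RP(F)/⟨ψ₁(x) : x ∈ F^×⟩`. -/
def qRP : Type := FreeRP F ⧸ Submodule.span (RF F) (ftRels F ∪ psiRels F)

instance : AddCommGroup (qRP F) := by unfold qRP; infer_instance
instance : Module (RF F) (qRP F) := by unfold qRP; infer_instance

/-- `[x] ∈ qRP(F)` -/
def qrp (x : Fˣ) : qRP F := Submodule.Quotient.mk (gen F x)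

/-- The module `RP′(F)`. -/
def RP' : Type :=
  FreeRP F ⧸ Submodule.span (RF F)
    ({gen F 1} ∪ ftRels F ∪ minusRels F ∪ invRels F)

instance : AddCommGroup (RP' F) := by unfold RP'; infer_instance
instance : Module (RF F) (RP' F) := by unfold RP'; infer_instance

/-- `[x] ∈ RP′(F)` -/
def rp (x : Fˣ) : RP' F := Submodule.Quotient.mk (gen F x)

/-- the submodule of `M` generated by the elements `(⟨a⟩ - χ(a))·m`. -/
def chiSub (χ : SqCl F →* ℤˣ) (M : Type) [AddCommGroup M] [Module (RF F) M] :
    Submodule (RF F) M :=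
  Submodule.span (RF F)
    {w | ∃ (a : Fˣ) (m : M), w = cls F a • m - ((χ (sqc F a) : ℤ)) • m}

/-- `M_χ` -/
def ChiQuot (χ : SqCl F →* ℤˣ) (M : Type) [AddCommGroup M] [Module (RF F) M] : Type :=
  M ⧸ chiSub F χ M

instance (χ : SqCl F →* ℤˣ) (M : Type) [AddCommGroup M] [Module (RF F) M] :
    AddCommGroup (ChiQuot F χ M) := by unfold ChiQuot; infer_instance
instance (χ : SqCl F →* ℤˣ) (M : Type) [AddCommGroup M] [Module (RF F) M] :
    Module (RF F) (ChiQuot F χ M) := by unfold ChiQuot; infer_instance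

/-- image of `m` in `M_χ` -/
def mkChi (χ : SqCl F →* ℤˣ) {M : Type} [AddCommGroup M] [Module (RF F) M] (m : M) :
    ChiQuot F χ M := Submodule.Quotient.mk m

/-- `M[1/2]`, as an `R_F`-module (localization at the powers of `2`). -/
def Loc2 (M : Type) [AddCommGroup M] [Module (RF F) M] : Type :=
  LocalizedModule (Submonoid.powers (2 : RF F)) M

instance (M : Type) [AddCommGroup M] [Module (RF F) M] : AddCommGroup (Loc2 F M) := by
  unfold Loc2; infer_instance
instance (M : Type) [AddCommGroup M] [Module (RF F) M] : Module (RF F) (Loc2 F M) := by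
  unfold Loc2; infer_instance

/-- the canonical map `M → M[1/2]` -/
def toLoc2 {M : Type} [AddCommGroup M] [Module (RF F) M] (m : M) : Loc2 F M :=
  LocalizedModule.mkLinearMap (Submonoid.powers (2 : RF F)) M m


/-- the square class of a field element (junk value `1` at `0`). -/
def sqv (a : F) : SqCl F := if h : a ≠ 0 then sqc F (U F a h) else 1

/-- `[a] ∈ RP′(F)` for a field element `a`, where `[0]` is assigned the value `c₀`. -/
def rpc (c₀ : RP' F) (a : F) : RP' F := if h : a ≠ 0 then rp F (U F a h) else c₀


section PreBloch

variable (k : Type) [Field k]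

/-- The plain five-term relation in the free abelian group on `k^×`. -/
def FTZ (x y : kˣ) (hx : (x : k) ≠ 1) (hy : (y : k) ≠ 1) : kˣ →₀ ℤ :=
  Finsupp.single x 1 - Finsupp.single y 1 + Finsupp.single (y * x⁻¹) 1
    - Finsupp.single (U k ((1 - (x : k)⁻¹) / (1 - (y : k)⁻¹))
        (div_ne_zero (one_sub_inv_ne hx) (one_sub_inv_ne hy))) 1
    + Finsupp.single (U k ((1 - (x : k)) / (1 - (y : k)))
        (div_ne_zero (one_sub_ne hx) (one_sub_ne hy))) 1

/-- The pre-Bloch (scissors congruence) group `P(k)`: generators `[x]`, `x ∈ k^×`,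
relations `[1] = 0` and the five-term relations. -/
def PBloch : Type :=
  (kˣ →₀ ℤ) ⧸ Submodule.span ℤ
    ({Finsupp.single (1 : kˣ) (1 : ℤ)} ∪
      {w | ∃ (x y : kˣ) (hx : (x : k) ≠ 1) (hy : (y : k) ≠ 1), w = FTZ k x y hx hy})

instance : AddCommGroup (PBloch k) := by unfold PBloch; infer_instance

/-- `[x] ∈ P(k)` -/
def pb (x : kˣ) : PBloch k := Submodule.Quotient.mk (Finsupp.single x 1)

end PreBloch

section Conventions

variable (k : Type) [Field k]

/-- The augmentation `R_F → ℤ`. -/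
def augRF : RF k →+* ℤ := ((MonoidAlgebra.lift ℤ ℤ (SqCl k)) 1).toRingHom

/-- The augmentation ideal `I_F ⊆ R_F`. -/
def augIdeal : Ideal (RF k) := RingHom.ker (augRF k)

/-- the trivial `R_k`-module structure on an abelian group -/
def trivMod (M : Type) [AddCommGroup M] : Module (RF k) M := Module.compHom _ (augRF k)

/-- `RP′(F₃)`: the appropriate quotient of the cyclic `R_{F₃}`-module generated by
`[-1]` with the relation `2([-1] + ⟨-1⟩[-1]) = 0`. -/
def RP'3 : Type :=
  RF k ⧸ Submodule.span (RF k)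
    {(2 : RF k) * (1 + cls k (-1)), cls k (-1) - 1, 1 + cls k (-1)}

instance : AddCommGroup (RP'3 k) := by unfold RP'3; infer_instance
instance : Module (RF k) (RP'3 k) := by unfold RP'3; infer_instance

/-- `qRP(F₃) = RP(F₃)/⟨ψ₁⟩`, where `RP(F₃)` is the cyclic `R_{F₃}`-module generated
by `[-1]` with the relation `2([-1] + ⟨-1⟩[-1]) = 0`. -/
def qRP3 : Type :=
  RF k ⧸ Submodule.span (RF k) {(2 : RF k) * (1 + cls k (-1)), 1 + cls k (-1)}

instance : AddCommGroup (qRP3 k) := by unfold qRP3; infer_instance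
instance : Module (RF k) (qRP3 k) := by unfold qRP3; infer_instance

/-- `RP′(k)` (bundled), with the conventions for the fields with `2` and `3`
elements:  for `|k| = 2` it is `ℤ/3` with the trivial `R_k`-action, and for
`|k| = 3` it is the module `RP'3 k` above. -/
noncomputable def RP'Kb : ModuleCat (RF k) :=
  if Nat.card k = 2 then (letI := trivMod k (ZMod 3); ModuleCat.of (RF k) (ZMod 3))
  else if Nat.card k = 3 then ModuleCat.of (RF k) (RP'3 k)
  else ModuleCat.of (RF k) (RP' k)

/-- `RP′(k)`, with the conventions for the fields with `2` and `3` elements. -/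
noncomputable abbrev RP'K : Type := (RP'Kb k).carrier

/-- the generators `[u]`, `u ∈ k^×`, of `RP′(k)` (with the small-field conventions;
for `|k| = 2` one has `[1] = 0`, and for `|k| = 3`, `[1] = 0` and `[-1]` is the
distinguished generator) -/
noncomputable def rpK : kˣ → RP'K k := by
  unfold RP'K RP'Kb
  by_cases h2 : Nat.card k = 2
  · rw [if_pos h2]; exact fun _ => 0
  · rw [if_neg h2]
    by_cases h3 : Nat.card k = 3
    · rw [if_pos h3]
      exact fun u => if (u : k) = 1 then 0 else Submodule.Quotient.mk (1 : RF k)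
    · rw [if_neg h3]; exact rp k

/-- `qRP(k)` (bundled), with the conventions for the fields with `2` and `3`
elements. -/
noncomputable def qRPKb : ModuleCat (RF k) :=
  if Nat.card k = 2 then (letI := trivMod k (ZMod 3); ModuleCat.of (RF k) (ZMod 3))
  else if Nat.card k = 3 then ModuleCat.of (RF k) (qRP3 k)
  else ModuleCat.of (RF k) (qRP k)

/-- `qRP(k)`, with the conventions for the fields with `2` and `3` elements. -/
noncomputable abbrev qRPK : Type := (qRPKb k).carrier

/-- the generators `[u]`, `u ∈ k^×`, of `qRP(k)` (with the small-field conventions) -/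
noncomputable def qrpK : kˣ → qRPK k := by
  unfold qRPK qRPKb
  by_cases h2 : Nat.card k = 2
  · rw [if_pos h2]; exact fun _ => 0
  · rw [if_neg h2]
    by_cases h3 : Nat.card k = 3
    · rw [if_pos h3]
      exact fun u => if (u : k) = 1 then 0 else Submodule.Quotient.mk (1 : RF k)
    · rw [if_neg h3]; exact qrp k

/-- The scissors congruence group `P(k)`, with the conventions for the fields with
`2` and `3` elements (`P(F₂) = ℤ/3` and `P(F₃) = ℤ/4`, generated by `[-1]`). -/
def PBK : Type :=
  if Nat.card k = 2 then ZMod 3 else if Nat.card k = 3 then ZMod 4 else PBloch k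

noncomputable instance : AddCommGroup (PBK k) := by
  unfold PBK; split
  · infer_instance
  · split <;> infer_instance

/-- the generators `[u]`, `u ∈ k^×`, of `P(k)` (with the small-field conventions) -/
noncomputable def pbK' : kˣ → PBK k := by
  unfold PBK
  by_cases h2 : Nat.card k = 2
  · rw [if_pos h2]; exact fun _ => 0
  · rw [if_neg h2]
    by_cases h3 : Nat.card k = 3
    · rw [if_pos h3]
      exact fun u => if (u : k) = 1 then 0 else (1 : ZMod 4)
    · rw [if_neg h3]; exact pb k

end Conventions

section ValuedField

variable (F : Type) [Field F] {Γ₀ : Type} [LinearOrderedCommGroupWithZero Γ₀]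
variable (v : Valuation F Γ₀)

/-- The residue field `k(v)` of the valuation ring of `v`. -/
def Resk : Type := IsLocalRing.ResidueField ↥v.valuationSubring

instance : Field (Resk F v) := by unfold Resk; infer_instance

/-- the unit group `U_v` of the valuation ring -/
def Uv : Type := (↥v.valuationSubring)ˣ

instance : CommGroup (Uv F v) := by unfold Uv; infer_instance

/-- `ℤ[U_v]` -/
def ZU : Type := MonoidAlgebra ℤ (Uv F v)

instance : CommRing (ZU F v) := by unfold ZU; infer_instance

/-- `U_v →* F^×` -/
def uvToUnits : Uv F v →* Fˣ := Units.map (v.valuationSubring.subtype).toMonoidHom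

/-- `U_v →* k^×` (reduction modulo the maximal ideal) -/
def uvToResUnits : Uv F v →* (Resk F v)ˣ :=
  Units.map (IsLocalRing.residue ↥v.valuationSubring).toMonoidHom

/-- `ℤ[U_v] → R_F` -/
def zuF : ZU F v →+* RF F :=
  MonoidAlgebra.mapDomainRingHom ℤ ((sqc F).comp (uvToUnits F v))

/-- `ℤ[U_v] → R_{k(v)}` -/
def zuK : ZU F v →+* RF (Resk F v) :=
  MonoidAlgebra.mapDomainRingHom ℤ ((sqc (Resk F v)).comp (uvToResUnits F v))

/-- `Ind_F^k M = R_F ⊗_{ℤ[U_v]} M` for an `R_k`-module `M`. -/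
def IndMod (M : Type) [AddCommGroup M] [Module (RF (Resk F v)) M] : Type :=
  @TensorProduct (ZU F v) _ (RF F) M _ _
    (Module.compHom _ (zuF F v)) (Module.compHom _ (zuK F v))

noncomputable instance (M : Type) [AddCommGroup M] [Module (RF (Resk F v)) M] :
    AddCommGroup (IndMod F v M) := by
  unfold IndMod
  letI : Module (ZU F v) (RF F) := Module.compHom _ (zuF F v)
  letI : Module (ZU F v) M := Module.compHom _ (zuK F v)
  infer_instance

noncomputable instance (M : Type) [AddCommGroup M] [Module (RF (Resk F v)) M] :
    Module (RF F) (IndMod F v M) := by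
  unfold IndMod
  letI : Module (ZU F v) (RF F) := Module.compHom _ (zuF F v)
  letI : Module (ZU F v) M := Module.compHom _ (zuK F v)
  letI : SMulCommClass (ZU F v) (RF F) (RF F) :=
    ⟨fun r s t => by
      show zuF F v r * (s * t) = s * (zuF F v r * t)
      ring⟩
  exact TensorProduct.leftModule

/-- the element `r ⊗ m` of `Ind_F^k M` -/
noncomputable def indE (M : Type) [AddCommGroup M] [Module (RF (Resk F v)) M]
    (r : RF F) (m : M) : IndMod F v M :=
  letI : Module (ZU F v) (RF F) := Module.compHom _ (zuF F v)
  letI : Module (ZU F v) M := Module.compHom _ (zuK F v)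
  r ⊗ₜ[ZU F v] m

/-- a unit of `F` of valuation `1` gives a unit of the valuation ring -/
def unitOfVal (x : Fˣ) (hx : v (x : F) = 1) : Uv F v :=
  { val := ⟨(x : F), le_of_eq hx⟩
    inv := ⟨((x : F)⁻¹),
      by
        rw [Valuation.mem_valuationSubring_iff, map_inv₀, hx, inv_one]⟩
    val_inv := by
      apply Subtype.ext
      simp [mul_inv_cancel₀ (Units.ne_zero x)]
    inv_val := by
      apply Subtype.ext
      simp [inv_mul_cancel₀ (Units.ne_zero x)] }

/-- the image in `k(v)^×` of a unit of `F` of valuation `1` -/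
def resUnit (x : Fˣ) (hx : v (x : F) = 1) : (Resk F v)ˣ :=
  uvToResUnits F v (unitOfVal F v x hx)

end ValuedField

section DiscreteValuationChar

variable (F : Type) [Field F]

/-- The character `χ_v : G_F → {±1}`, `⟨a⟩ ↦ (-1)^{v(a)}`, associated to a
homomorphism `v : F^× → ℤ`. -/
def chiV (v : Fˣ → ℤ) (hv : ∀ x y : Fˣ, v (x * y) = v x + v y) : SqCl F →* ℤˣ :=
  QuotientGroup.lift _
    { toFun := fun x => (-1 : ℤˣ) ^ (v x)
      map_one' := by
        have h1 : v 1 = v 1 + v 1 := by simpa using (hv 1 1).symm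
        have h0 : v 1 = 0 := by omega
        simp [h0]
      map_mul' := fun x y => by simp only [hv, zpow_add] }
    (by
      rintro w ⟨y, rfl⟩
      show (-1 : ℤˣ) ^ (v (y ^ 2)) = 1
      have : v (y ^ 2) = v y + v y := by rw [pow_two]; exact hv y y
      rw [this, zpow_add]
      exact Int.units_mul_self _)

/-- The set `U_n = 1 + M_v^n ⊆ F^×` for a discrete valuation `v`. -/
def UnSet (v : Fˣ → ℤ) (n : ℕ) : Set Fˣ :=
  {u : Fˣ | (u : F) = 1 ∨ ∃ h : (u : F) - 1 ≠ 0, (n : ℤ) ≤ v (U F ((u : F) - 1) h)}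

end DiscreteValuationChar

section DiscreteValuationZ

variable (F : Type) [Field F]

/-- the additive value `v(x) ∈ ℤ` of a unit, for a (multiplicatively written)
valuation `v : F → ℤₘ₀` -/
def vzk (v : Valuation F (WithZero (Multiplicative ℤ))) (x : Fˣ) : ℤ :=
  - Multiplicative.toAdd (WithZero.unzero ((Valuation.ne_zero_iff v).mpr (Units.ne_zero x)))

theorem vzk_mul (v : Valuation F (WithZero (Multiplicative ℤ))) (x y : Fˣ) :
    vzk F v (x * y) = vzk F v x + vzk F v y := by
  have h1 : v ((↑(x * y) : F)) ≠ 0 := (Valuation.ne_zero_iff v).mpr (Units.ne_zero (x * y))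
  have h2 : v ((x : F)) ≠ 0 := (Valuation.ne_zero_iff v).mpr (Units.ne_zero x)
  have h3 : v ((y : F)) ≠ 0 := (Valuation.ne_zero_iff v).mpr (Units.ne_zero y)
  have key : WithZero.unzero h1 = WithZero.unzero h2 * WithZero.unzero h3 := by
    rw [← WithZero.coe_inj, WithZero.coe_mul, WithZero.coe_unzero, WithZero.coe_unzero,
      WithZero.coe_unzero, Units.val_mul, map_mul]
  unfold vzk
  show -Multiplicative.toAdd (WithZero.unzero h1) =
      -Multiplicative.toAdd (WithZero.unzero h2) + -Multiplicative.toAdd (WithZero.unzero h3)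
  rw [key, toAdd_mul]
  ring

/-- the character `χ_v` of a (surjective) discrete valuation `v : F → ℤₘ₀` -/
def chiVal (v : Valuation F (WithZero (Multiplicative ℤ))) : SqCl F →* ℤˣ :=
  chiV F (vzk F v) (vzk_mul F v)

/-- The subset `U_n = 1 + M_v^n` of `F^×`, for a surjective discrete valuation
`v : F → ℤₘ₀`:  the units `u` with `v(u - 1) ≥ n` (additively). -/
def UnV (v : Valuation F (WithZero (Multiplicative ℤ))) (n : ℕ) : Set Fˣ :=
  {u : Fˣ | ∀ h : (u : F) - 1 ≠ 0, (n : ℤ) ≤ vzk F v (U F ((u : F) - 1) h)}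

end DiscreteValuationZ

section KvMathlib

variable (F : Type) [Field F] {Γ₀ : Type} [LinearOrderedCommGroupWithZero Γ₀]

/-- `1 + M_v ⊆ F^×` -/
def U1V (v : Valuation F Γ₀) : Set Fˣ := {u : Fˣ | v ((u : F) - 1) < 1}

/-- `K_v ⊆ qRP(F)`: the `R_F`-submodule generated by the `[u]` with `u ∈ 1 + M_v`. -/
def KvV (v : Valuation F Γ₀) : Submodule (RF F) (qRP F) :=
  Submodule.span (RF F) (qrp F '' U1V F v)

end KvMathlib
end

structure Core (F : Type) [Field F] (N : Type) [AddCommGroup N] (χ : F →*₀ ℤ) (p : F → N) : Prop where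
  sgn : ∀ x, x ≠ 0 → χ x = 1 ∨ χ x = -1
  neg1 : χ (-1) = 1
  nt : ∃ a, χ a = -1
  tf : ∀ n : N, n + n = 0 → n = 0
  one : p 1 = 0
  inv : ∀ x, x ≠ 0 → p x⁻¹ = - p x
  ft : ∀ x y, x ≠ 0 → y ≠ 0 → x ≠ 1 → y ≠ 1 →
    p x - p y + χ x • p (y / x) - (χ x * χ (1 - x)) • p (y * (1 - x) / (x * (1 - y)))
      + χ (1 - x) • p ((1 - x) / (1 - y)) = 0

namespace Core

variable {F : Type} [Field F] {N : Type} [AddCommGroup N] {χ : F →*₀ ℤ} {p : F → N}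

theorem chi_ne {x : F} {e : ℤ} (h : χ x = e) (he : e ≠ 0) : x ≠ 0 := by
  rintro rfl; rw [map_zero] at h; exact he h.symm

theorem m {x y z : F} (χ : F →*₀ ℤ) (h : x * y = z) : χ x * χ y = χ z := by rw [← map_mul, h]

theorem sq (H : Core F N χ p) {x : F} (hx : x ≠ 0) : χ x * χ x = 1 := by
  rcases H.sgn x hx with h | h <;> rw [h] <;> rfl

theorem neg (H : Core F N χ p) (x : F) : χ (-x) = χ x := by
  rw [neg_eq_neg_one_mul, map_mul, H.neg1, one_mul]

theorem sub_comm (H : Core F N χ p) (x y : F) : χ (x - y) = χ (y - x) := by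
  rw [← neg_sub, H.neg]

theorem chi_inv (H : Core F N χ p) (x : F) : χ x⁻¹ = χ x := by
  by_cases hx : x = 0
  · simp [hx]
  have h1 := H.sq hx
  have h2 : χ x * χ x⁻¹ = 1 := by rw [← map_mul, mul_inv_cancel₀ hx, map_one]
  rcases H.sgn x hx with h | h <;> rw [h] at h2 ⊢ <;> omega

theorem chi_div (H : Core F N χ p) (x y : F) : χ (x / y) = χ x * χ y := by
  rw [div_eq_mul_inv, map_mul, H.chi_inv]

theorem const (H : Core F N χ p) {x y : F} (hx : x ≠ 0) (hx1 : x ≠ 1) (hy : y ≠ 0) (hy1 : y ≠ 1) :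
    p x + p (1 - x) = p y + p (1 - y) := by
  have e1 := H.ft x y hx hy hx1 hy1
  have e2 := H.ft (1 - x) (1 - y) (sub_ne_zero.2 hx1.symm) (sub_ne_zero.2 hy1.symm)
    (by simpa using hx) (by simpa using hy)
  rw [sub_sub_cancel, sub_sub_cancel] at e2
  have hx1' := sub_ne_zero.2 hx1.symm
  have hy1' := sub_ne_zero.2 hy1.symm
  have i1 := H.inv (y / x) (div_ne_zero hy hx)
  have i2 := H.inv ((1 - x) / (1 - y)) (div_ne_zero hx1' hy1')
  have i3 := H.inv (y * (1 - x) / (x * (1 - y))) (by positivity)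
  rw [inv_div] at i1 i2 i3
  rw [i1, i2, show (1 - y) * x / ((1 - x) * y) = x * (1 - y) / (y * (1 - x)) by ring, i3] at e2
  linear_combination (norm := module) e1 + e2

theorem three (H : Core F N χ p) {x : F} (hx : x ≠ 0) (hx1 : x ≠ 1) :
    (3 : ℤ) • (p x + p (1 - x)) = 0 := by
  have hx1' := sub_ne_zero.2 hx1.symm
  have hi : x⁻¹ ≠ 1 := by simpa using hx1
  have c1 := H.const hx hx1 (inv_ne_zero hx) hi
  have h3 : (1 - x)⁻¹ ≠ 1 := by simpa using hx
  have c2 := H.const hx hx1 (inv_ne_zero hx1') h3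
  have e : 1 - (1 - x)⁻¹ = (1 - x⁻¹)⁻¹ := by
    have h4 : 1 - x⁻¹ = -(1 - x) / x := by field_simp; ring
    rw [h4, inv_div]
    field_simp
    ring
  rw [e, H.inv _ hx1', H.inv _ (sub_ne_zero.2 hi.symm)] at c2
  rw [H.inv _ hx] at c1
  linear_combination (norm := module) c1 + c2

theorem l3 (H : Core F N χ p) {b c : F} (hb : χ b = -1) (hc : χ c = -1) :
    χ (1 - b) • p b = χ (1 - c) • p c := by
  have hb0 : b ≠ 0 := chi_ne hb (by norm_num)
  have hc0 : c ≠ 0 := chi_ne hc (by norm_num)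
  have hb1 : b ≠ 1 := by rintro rfl; simp at hb
  have hc1 : c ≠ 1 := by rintro rfl; simp at hc
  have hb1' := sub_ne_zero.2 hb1.symm
  have hc1' := sub_ne_zero.2 hc1.symm
  by_cases hbc : b * c = 1
  · have : c = b⁻¹ := eq_inv_of_mul_eq_one_right hbc
    subst this
    rw [H.inv _ hb0]
    have := m χ (show (1 - b⁻¹) * b = -(1 - b) by field_simp; ring)
    rw [H.neg, hb] at this
    rw [← this]; module
  have hbc' : b * c - 1 ≠ 0 := sub_ne_zero.2 hbc
  have hbc2 : c * b - 1 ≠ 0 := by rwa [mul_comm]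
  set x := (c - 1) / (b * c - 1) with hxd
  have hx1e : 1 - x = c * (b - 1) / (b * c - 1) := by rw [hxd]; field_simp; ring
  have hy1e : 1 - b * x = (b - 1) / (b * c - 1) * (1) := by rw [hxd]; field_simp; ring
  have hc2 : c - 1 ≠ 0 := sub_ne_zero.2 hc1
  have hb2 : b - 1 ≠ 0 := sub_ne_zero.2 hb1
  have hx0 : x ≠ 0 := div_ne_zero hc2 hbc'
  have hx1 : 1 - x ≠ 0 := by rw [hx1e]; exact div_ne_zero (mul_ne_zero hc0 hb2) hbc'
  have hy1 : 1 - b * x ≠ 0 := by rw [hy1e, mul_one]; exact div_ne_zero hb2 hbc'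
  have hy0 : b * x ≠ 0 := mul_ne_zero hb0 hx0
  have hx1' : x ≠ 1 := fun h => hx1 (by rw [h, sub_self])
  have hy1' : b * x ≠ 1 := fun h => hy1 (by rw [h, sub_self])
  have f1 := H.ft x (b * x) hx0 hy0 hx1' hy1'
  have f2 := H.ft (b * x) x hy0 hx0 hy1' hx1'
  have ecc : (1 - x) / (1 - b * x) = c := by rw [hx1e, hy1e]; field_simp
  have eb : b * x / x = b := by field_simp
  have eb' : x / (b * x) = b⁻¹ := by field_simp
  have ec' : (1 - b * x) / (1 - x) = c⁻¹ := by rw [← ecc, inv_div]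
  have i3 := H.inv (b * x * (1 - x) / (x * (1 - b * x))) (by positivity)
  rw [inv_div] at i3
  rw [ecc, eb] at f1
  rw [ec', eb', H.inv _ hb0, H.inv _ hc0, i3] at f2
  have k1 : χ (b * x) = - χ x := by rw [map_mul, hb]; ring
  have k2 := m χ (show c * (1 - b * x) = 1 - x by rw [hx1e, hy1e]; ring)
  rw [hc] at k2
  have k3 : χ (1 - b * x) = - χ (1 - x) := by omega
  rw [k1, k3] at f2
  have k4 := m χ (show (1 - x) * (c - 1) = x * (c * (b - 1)) by rw [hx1e, hxd]; ring)
  rw [map_mul, map_mul χ c, hc, H.sub_comm c, H.sub_comm b] at k4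
  have t := H.tf (χ x • p b + χ (1 - x) • p c) (by linear_combination (norm := module) f1 + f2)
  rcases H.sgn _ hx0 with s1 | s1 <;> rcases H.sgn _ hx1 with s2 | s2 <;>
    rcases H.sgn _ hb1' with s3 | s3 <;> rcases H.sgn _ hc1' with s4 | s4 <;>
    rw [s1, s2, s3, s4] at k4 <;> norm_num at k4 <;> rw [s1, s2] at t <;> rw [s3, s4] <;>
    first
    | linear_combination (norm := module) t
    | linear_combination (norm := module) -t

/-- the constant `C` -/
def IsC (p : F → N) (C : N) : Prop := ∀ x : F, x ≠ 0 → x ≠ 1 → p x + p (1 - x) = C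

theorem l4 (H : Core F N χ p) {C : N} (hC : IsC p C) {x : F} (hx : χ x = -1) :
    p x = χ (1 - x) • C := by
  have key : ∀ z : F, χ z = -1 → χ (1 - z) = -1 → p z = - C := by
    intro z hz hz1
    have hz0 : z ≠ 0 := chi_ne hz (by norm_num)
    have hz1' : z ≠ 1 := by rintro rfl; simp at hz
    have h := H.l3 hz hz1
    rw [sub_sub_cancel, hz, hz1] at h
    have c := hC z hz0 hz1'
    have t := H.three hz0 hz1'
    rw [c] at t
    have t3 := H.tf ((3 : ℤ) • p z) (by linear_combination (norm := module) t + (3 : ℤ) • c - (3 : ℤ) • h)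
    linear_combination (norm := module) t3 - c + h
  have hx0 : x ≠ 0 := chi_ne hx (by norm_num)
  have hx1 : x ≠ 1 := by rintro rfl; simp at hx
  rcases H.sgn _ (sub_ne_zero.2 hx1.symm) with h | h
  · have := m χ (show (1 - x⁻¹) * x = -(1 - x) by field_simp; ring)
    rw [H.neg, hx, h] at this
    have k := key x⁻¹ (by rw [H.chi_inv, hx]) (by omega)
    rw [H.inv _ hx0] at k
    rw [h, one_smul]; exact neg_inj.1 k
  · rw [key x hx h, h]; module

theorem l5 (H : Core F N χ p) {C : N} (hC : IsC p C) {x : F} (hx : χ x = 1) (hx1 : χ (1 - x) = -1) :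
    p x = 0 := by
  have hx0 : x ≠ 0 := chi_ne hx (by norm_num)
  have hx1' : x ≠ 1 := by rintro rfl; simp at hx1
  have h := H.l4 hC hx1
  rw [sub_sub_cancel, hx] at h
  linear_combination (norm := module) hC x hx0 hx1' - h

theorem l6 (H : Core F N χ p) {C : N} (hC : IsC p C) {s w : F} (hs : χ s = 1) (hs1 : χ (1 - s) = 1)
    (hw : χ w = 1) (hw1 : χ (1 - w) = -1) : p (s / w) = p s := by
  have hs0 : s ≠ 0 := chi_ne hs (by norm_num)
  have hw0 : w ≠ 0 := chi_ne hw (by norm_num)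
  have hs1' : 1 - s ≠ 0 := chi_ne hs1 (by norm_num)
  have hw1' : 1 - w ≠ 0 := chi_ne hw1 (by norm_num)
  have f := H.ft (1 - s) (1 - w) hs1' hw1' (by simpa using hs0) (by simpa using hw0)
  rw [sub_sub_cancel, sub_sub_cancel, hs1, hs] at f
  have c := hC s hs0 (fun h => hs1' (by rw [h, sub_self]))
  have a1 := H.l4 hC hw1
  rw [sub_sub_cancel, hw] at a1
  have a2 := H.l4 hC (x := (1 - w) / (1 - s)) (by rw [H.chi_div, hs1, hw1]; rfl)
  have a3 := H.l4 hC (x := (1 - w) * s / ((1 - s) * w))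
    (by rw [H.chi_div, map_mul, map_mul, hs1, hw1, hs, hw]; rfl)
  rw [show 1 - (1 - w) / (1 - s) = (w - s) / (1 - s) by field_simp; ring, H.chi_div, hs1] at a2
  rw [show 1 - (1 - w) * s / ((1 - s) * w) = (w - s) / ((1 - s) * w) by field_simp; ring, H.chi_div,
    map_mul, hs1, hw] at a3
  rw [a1, a2, a3] at f
  linear_combination (norm := module) f - c

theorem l7 (H : Core F N χ p) {C : N} (hC : IsC p C) {s w : F} (hs : χ s = 1)
    (hw : χ w = 1) (hw1 : χ (1 - w) = -1) : p (s / w) = p s := by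
  have hw0 : w ≠ 0 := chi_ne hw (by norm_num)
  have hs0 : s ≠ 0 := chi_ne hs (by norm_num)
  by_cases h1 : s = 1
  · subst h1
    rw [one_div, H.inv _ hw0, H.l5 hC hw hw1, H.one, neg_zero]
  rcases H.sgn _ (sub_ne_zero.2 (Ne.symm h1)) with h | h
  · exact H.l6 hC hs h hw hw1
  rw [H.l5 hC hs h]
  by_cases h2 : s / w = 1
  · rw [h2, H.one]
  have hsw : χ (s / w) = 1 := by rw [H.chi_div, hs, hw]; rfl
  rcases H.sgn _ (sub_ne_zero.2 (Ne.symm h2)) with h' | h'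
  · have := m χ (show (1 - w⁻¹) * w = -(1 - w) by field_simp; ring)
    rw [H.neg, hw, hw1] at this
    have := H.l6 hC hsw h' (w := w⁻¹) (by rw [H.chi_inv, hw]) (by omega)
    rw [← this, show s / w / w⁻¹ = s by field_simp, H.l5 hC hs h]
  · exact H.l5 hC hsw h'

theorem l7' (H : Core F N χ p) {C : N} (hC : IsC p C) {s w : F} (hs : χ s = 1)
    (hw : χ w = 1) (hw1 : χ (1 - w) = -1) : p (s * w) = p s := by
  have hw0 : w ≠ 0 := chi_ne hw (by norm_num)
  rw [← H.l7 hC (s := s * w) (by rw [map_mul, hs, hw]; rfl) hw hw1, mul_div_cancel_right₀ _ hw0]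

end Core

namespace Core

variable {F : Type} [Field F] {N : Type} [AddCommGroup N] {χ : F →*₀ ℤ} {p : F → N}

theorem v_one_sub {v : Valuation F (WithZero (Multiplicative ℤ))} {a : F} (h : v a < 1) :
    v (1 - a) = 1 := by
  rw [sub_eq_add_neg]; exact v.map_one_add_of_lt (by rwa [Valuation.map_neg])

theorem caseA1 (H : Core F N χ p) {C : N} (hC : IsC p C)
    (v : Valuation F (WithZero (Multiplicative ℤ))) {a : F} (hva : v a < 1) (ha : χ a = 1)
    (hq : χ (1 - a) = -1) (ht : ∀ t, v (t - 1) < v a → χ t = 1) :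
    ∀ x, x ≠ 0 → p x = 0 := by
  have ha0 : a ≠ 0 := chi_ne ha (by norm_num)
  have hv0 : 0 < v a := zero_lt_iff.2 ((Valuation.ne_zero_iff v).2 ha0)
  have hq0 : 1 - a ≠ 0 := chi_ne hq (by norm_num)
  have hvq := v_one_sub hva
  have key : ∀ t, v (t - 1) < v a → p t = 0 := by
    intro t h
    have h1 := ht t h
    rw [← H.l7' hC h1 ha hq]
    refine H.l5 hC (by rw [map_mul, h1, ha]; rfl) ?_
    have e : (1 - a) * (1 - a * (t - 1) / (1 - a)) = 1 - t * a := by field_simp; ring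
    rw [← m χ e, hq, ht]
    · rfl
    rw [sub_sub_cancel_left, Valuation.map_neg, map_div₀, map_mul, hvq, div_one]
    calc v a * v (t - 1) < v a * 1 := by
          apply mul_lt_mul_of_pos_left (h.trans hva) hv0
      _ = v a := mul_one _
  have hlow : ∀ y, y ≠ 0 → v y < v a → p y = C := by
    intro y hy0 hy
    have h := hC y hy0 (by rintro rfl; rw [map_one] at hy; exact absurd hy (not_lt.2 hva.le))
    rw [key (1 - y) (by rwa [sub_sub_cancel_left, Valuation.map_neg]), add_zero] at h
    exact h
  have hC0 : C = 0 := by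
    rw [← hlow (a * a) (mul_ne_zero ha0 ha0), H.l7' hC ha ha hq, H.l5 hC ha hq]
    rw [map_mul]
    calc v a * v a < v a * 1 := mul_lt_mul_of_pos_left hva hv0
      _ = v a := mul_one _
  subst hC0
  intro x hx0
  rcases H.sgn x hx0 with h | h
  · have hpow : ∀ n : ℕ, p (x * a ^ n) = p x ∧ χ (x * a ^ n) = 1 := by
      intro n
      induction n with
      | zero => simp [h]
      | succ n ih =>
        rw [pow_succ, ← mul_assoc, H.l7' hC ih.2 ha hq, map_mul χ _ a, ih.2, ha]
        exact ⟨ih.1, rfl⟩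
    have hvx := (Valuation.ne_zero_iff v).2 hx0
    obtain ⟨n, hn⟩ := exists_pow_lt₀ hva (Units.mk0 (v a / v x) (div_ne_zero hv0.ne' hvx))
    rw [← (hpow n).1]
    apply hlow _ (mul_ne_zero hx0 (pow_ne_zero _ ha0))
    rw [map_mul, map_pow, mul_comm]
    exact (lt_div_iff₀ (zero_lt_iff.2 hvx)).1 hn
  · rw [H.l4 hC h, smul_zero]

theorem caseA (H : Core F N χ p) {C : N} (hC : IsC p C)
    (v : Valuation F (WithZero (Multiplicative ℤ))) {a : F} (hva : v a < 1)
    (hq : χ (1 - a) = -1) (ht : ∀ t, v (t - 1) < v a → χ t = 1) :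
    ∀ x, x ≠ 0 → p x = 0 := by
  have ha0 : a ≠ 0 := by rintro rfl; simp at hq
  have hv0 : 0 < v a := zero_lt_iff.2 ((Valuation.ne_zero_iff v).2 ha0)
  have hq0 : 1 - a ≠ 0 := chi_ne hq (by norm_num)
  have hvq := v_one_sub hva
  rcases H.sgn a ha0 with h | h
  · exact H.caseA1 hC v hva h hq ht
  have hv' : v (a * (1 - a)) = v a := by rw [map_mul, hvq, mul_one]
  refine H.caseA1 hC v (a := a * (1 - a)) (by rwa [hv']) (by rw [map_mul, h, hq]; rfl) ?_
    (by rwa [hv'])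
  have e : (1 - a) * (1 + a * a / (1 - a)) = 1 - a * (1 - a) := by field_simp; ring
  rw [← m χ e, hq, ht]
  · rfl
  rw [add_sub_cancel_left, map_div₀, map_mul, hvq, div_one]
  calc v a * v a < v a * 1 := mul_lt_mul_of_pos_left hva hv0
    _ = v a := mul_one _

theorem caseB (H : Core F N χ p) {C : N} (hC : IsC p C)
    (v : Valuation F (WithZero (Multiplicative ℤ))) {ϖ : F} (hϖ0 : ϖ ≠ 0) (hϖ : v ϖ < 1)
    (hu : ∀ x, v x < 1 → v x ≤ v ϖ) (ht : ∀ t, v (t - 1) < 1 → χ t = 1) {s t : F}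
    (hs : χ s = 1) (h : v (t - 1) < 1) : p (s * t) = p s := by
  have hvϖ : v ϖ ≠ 0 := (Valuation.ne_zero_iff v).2 hϖ0
  -- it suffices to find `b ∈ B` with `b * t ∈ B`
  have suff : ∀ b, χ b = 1 → χ (1 - b) = -1 → χ (1 - b * t) = -1 → p (s * t) = p s := by
    intro b hb hb1 hb2
    have hb0 : b ≠ 0 := chi_ne hb (by norm_num)
    have hbt : χ (b * t) = 1 := by rw [map_mul, hb, ht t h]; rfl
    rw [← H.l7' hC hs hbt hb2, show s * (b * t) = s * t * b by ring,
      H.l7' hC (by rw [map_mul, hs, ht t h]; rfl) hb hb1]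
  by_cases hc : ∃ u, v u = 1 ∧ χ u = -1
  · obtain ⟨u, hvu, hu1⟩ := hc
    have hmain : ∀ u, v u = 1 → χ u = -1 → χ (1 - u) = 1 → p (s * t) = p s := by
      intro u hvu hu1 hu2
      have hu0 : u ≠ 0 := chi_ne hu1 (by norm_num)
      refine suff (1 - u) hu2 (by rwa [sub_sub_cancel]) ?_
      have e : u * (1 - (1 - u) * (t - 1) / u) = 1 - (1 - u) * t := by field_simp; ring
      rw [← m χ e, hu1, ht]
      · rfl
      rw [sub_sub_cancel_left, Valuation.map_neg, map_div₀, map_mul, hvu, div_one]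
      have h1 : v (1 - u) ≤ 1 := by
        refine (v.map_sub _ _).trans ?_
        simp [hvu]
      exact lt_of_le_of_lt (mul_le_of_le_one_left' h1) h
    have hu0 : u ≠ 0 := chi_ne hu1 (by norm_num)
    have hu1' : u ≠ 1 := by rintro rfl; simp at hu1
    rcases H.sgn _ (sub_ne_zero.2 hu1'.symm) with h3 | h3
    · exact hmain u hvu hu1 h3
    · have := m χ (show (1 - u⁻¹) * u = -(1 - u) by field_simp; ring)
      rw [H.neg, hu1, h3] at this
      exact hmain u⁻¹ (by rw [map_inv₀, hvu, inv_one]) (by rw [H.chi_inv, hu1]) (by omega)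
  · push Not at hc
    have hunit : ∀ u, v u = 1 → χ u = 1 := fun u hvu =>
      (H.sgn u ((Valuation.ne_zero_iff v).1 (by rw [hvu]; exact one_ne_zero))).resolve_right
        (hc u hvu)
    have hpi : χ ϖ = -1 := by
      refine (H.sgn ϖ hϖ0).resolve_left fun h1 => ?_
      have hlow : ∀ n : ℕ, ∀ x, x ≠ 0 → v ϖ ^ n < v x → v x ≤ 1 → χ x = 1 := by
        intro n
        induction n with
        | zero =>
          intro x hx0 hx hx'
          rw [pow_zero] at hx
          exact absurd hx (not_lt.2 hx')
        | succ n ih =>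
          intro x hx0 hx hx'
          rcases hx'.eq_or_lt with h4 | h4
          · exact hunit x h4
          have h5 := ih (x / ϖ) (div_ne_zero hx0 hϖ0)
            (by rw [map_div₀, lt_div_iff₀ (zero_lt_iff.2 hvϖ), ← pow_succ]; exact hx)
            (by rw [map_div₀]; exact (div_le_one₀ (zero_lt_iff.2 hvϖ)).2 (hu x h4))
          rw [H.chi_div, h1, mul_one] at h5
          exact h5
      have hle : ∀ x, x ≠ 0 → v x ≤ 1 → χ x = 1 := by
        intro x hx0 hx
        obtain ⟨n, hn⟩ := exists_pow_lt₀ hϖ (Units.mk0 (v x) ((Valuation.ne_zero_iff v).2 hx0))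
        exact hlow n x hx0 hn hx
      obtain ⟨a, ha⟩ := H.nt
      have ha0 : a ≠ 0 := chi_ne ha (by norm_num)
      rcases le_total (v a) 1 with h6 | h6
      · rw [hle a ha0 h6] at ha; omega
      · have h7 := hle a⁻¹ (inv_ne_zero ha0) (by rw [map_inv₀]; exact inv_le_one_of_one_le₀ h6)
        rw [H.chi_inv, ha] at h7
        omega
    by_cases ht1 : t = 1
    · rw [ht1, mul_one]
    have hd0 : 1 - t ≠ 0 := sub_ne_zero.2 (Ne.symm ht1)
    rcases H.sgn _ hd0 with h3 | h3
    · have hvd : v (1 - t) < 1 := by rwa [Valuation.map_sub_swap]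
      have hdpi : v ((1 - t) / ϖ) < 1 := by
        rw [map_div₀]
        refine lt_of_le_of_ne ((div_le_one₀ (zero_lt_iff.2 hvϖ)).2 (hu _ hvd)) fun h8 => ?_
        have := hunit ((1 - t) / ϖ) (by rw [map_div₀]; exact h8)
        rw [H.chi_div, hpi, h3] at this
        omega
      have hchi : χ ((1 - t) / ϖ) = -1 := by rw [H.chi_div, hpi, h3]; rfl
      refine suff (1 + (1 - t) / ϖ) (ht _ (by rwa [add_sub_cancel_left]))
        (by rwa [sub_add_cancel_left, H.neg]) ?_
      have e : ((1 - t) / ϖ) * (ϖ - t) = 1 - (1 + (1 - t) / ϖ) * t := by field_simp; ring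
      rw [← m χ e, hchi, H.sub_comm, ht]
      · rfl
      rw [show t - ϖ - 1 = (t - 1) - ϖ by ring]
      exact lt_of_le_of_lt (v.map_sub _ _) (max_lt h hϖ)
    · exact H.l7' hC hs (ht t h) h3

theorem caseB_low (H : Core F N χ p) {C : N} (hC : IsC p C)
    (v : Valuation F (WithZero (Multiplicative ℤ))) {ϖ : F} (hϖ0 : ϖ ≠ 0) (hϖ : v ϖ < 1)
    (hu : ∀ x, v x < 1 → v x ≤ v ϖ) (ht : ∀ t, v (t - 1) < 1 → χ t = 1) {x : F}
    (hx0 : x ≠ 0) (hx : v x < 1) : p x = C := by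
  have h1 : v (1 - x - 1) < 1 := by rwa [sub_sub_cancel_left, Valuation.map_neg]
  have h := hC x hx0 (by rintro rfl; simp at hx)
  have h2 := H.caseB hC v hϖ0 hϖ hu ht (s := 1) (map_one χ) h1
  rw [one_mul, H.one] at h2
  rw [h2, add_zero] at h
  exact h

theorem caseB_unit (H : Core F N χ p) {C : N} (hC : IsC p C)
    (v : Valuation F (WithZero (Multiplicative ℤ))) {ϖ : F} (hϖ0 : ϖ ≠ 0) (hϖ : v ϖ < 1)
    (hu : ∀ x, v x < 1 → v x ≤ v ϖ) (ht : ∀ t, v (t - 1) < 1 → χ t = 1) {s t : F}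
    (hs : v s = 1) (h : v (t - 1) < 1) : p (s * t) = p s := by
  have hs0 : s ≠ 0 := (Valuation.ne_zero_iff v).1 (by rw [hs]; exact one_ne_zero)
  rcases H.sgn s hs0 with h1 | h1
  · exact H.caseB hC v hϖ0 hϖ hu ht h1 h
  rw [H.l4 hC h1, H.l4 hC (by rw [map_mul, h1, ht t h]; rfl)]
  congr 1
  have h2 : v (1 - s) = 1 := by
    refine le_antisymm ((v.map_sub _ _).trans (by simp [hs])) (not_lt.1 fun h3 => ?_)
    rw [Valuation.map_sub_swap] at h3
    rw [ht s h3] at h1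
    omega
  have h20 : 1 - s ≠ 0 := (Valuation.ne_zero_iff v).1 (by rw [h2]; exact one_ne_zero)
  have e : (1 - s) * (1 - s * (t - 1) / (1 - s)) = 1 - s * t := by field_simp; ring
  rw [← m χ e, ht (1 - s * (t - 1) / (1 - s)), mul_one]
  rwa [sub_sub_cancel_left, Valuation.map_neg, map_div₀, map_mul, h2, div_one, hs, one_mul]

end Core

section Part3
variable {F : Type} [Field F]

theorem sqc_surj (g : SqCl F) : ∃ x, sqc F x = g := QuotientGroup.mk'_surjective _ g

theorem sqc_sq (x : Fˣ) : sqc F (x * x) = 1 :=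
  (QuotientGroup.eq_one_iff _).2 ⟨x, by simp [pow_two]⟩

theorem sqcl_sq (g : SqCl F) : g * g = 1 := by
  obtain ⟨x, rfl⟩ := sqc_surj g
  rw [← map_mul, sqc_sq]

theorem cls_sq (a : Fˣ) : cls F a * cls F a = 1 := by
  unfold cls
  rw [← map_mul, sqcl_sq, map_one]

theorem exists_chi (M : Type) [AddCommGroup M] [Module (RF F) M]
    (h2 : ∀ x : M, (2 : RF F) • x = 0 → x = 0) (m : M) (hm : m ≠ 0) :
    ∃ χ : SqCl F →* ℤˣ, m ∉ chiSub F χ M := by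
  let J : Ideal (RF F) := LinearMap.ker (LinearMap.toSpanSingleton (RF F) M m)
  have hJ : ∀ r, r ∈ J ↔ r • m = 0 := fun r => by simp [J]
  have hpow : ∀ (n : ℕ) (x : M), (2 : RF F) ^ n • x = 0 → x = 0 := by
    intro n
    induction n with
    | zero => intro x hx; simpa using hx
    | succ n ih =>
      intro x hx
      rw [pow_succ, mul_smul] at hx
      exact h2 _ (ih _ hx)
  have hd : Disjoint (J : Set (RF F)) (Submonoid.powers (2 : RF F) : Set (RF F)) := by
    rw [Set.disjoint_left]
    rintro r hr ⟨n, rfl⟩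
    exact hm (hpow n m ((hJ _).1 hr))
  obtain ⟨P, hP, hJP, hPd⟩ := Ideal.exists_le_prime_disjoint J _ hd
  have h2P : (2 : RF F) ∉ P := fun h => (Set.disjoint_left.1 hPd) h ⟨1, pow_one _⟩
  let o : SqCl F →* RF F := MonoidAlgebra.of ℤ (SqCl F)
  have ho : ∀ g, o g * o g = 1 := fun g => by rw [← map_mul, sqcl_sq, map_one]
  have hdich : ∀ g, o g - 1 ∈ P ∨ o g + 1 ∈ P := fun g =>
    hP.mem_or_mem (by
      rw [show (o g - 1) * (o g + 1) = 0 by linear_combination ho g]; exact P.zero_mem)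
  have hnot : ∀ g, o g - 1 ∈ P → o g + 1 ∉ P := fun g h h' =>
    h2P (by have := P.sub_mem h' h; ring_nf at this; exact this)
  let χ : SqCl F →* ℤˣ :=
    { toFun := fun g => if o g - 1 ∈ P then 1 else -1
      map_one' := by simp
      map_mul' := fun g h => by
        have key : ∀ e₁ e₂ : RF F, o g - e₁ ∈ P → o h - e₂ ∈ P → o (g * h) - e₁ * e₂ ∈ P := by
          intro e₁ e₂ h1 h2
          rw [map_mul, show o g * o h - e₁ * e₂ = o h * (o g - e₁) + e₁ * (o h - e₂) by ring]
          exact P.add_mem (P.mul_mem_left _ h1) (P.mul_mem_left _ h2)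
        by_cases hg : o g - 1 ∈ P <;> by_cases hh : o h - 1 ∈ P
        · have := key 1 1 hg hh
          rw [mul_one] at this
          rw [if_pos this]; simp [hg, hh]
        · have hh' := (hdich h).resolve_left hh
          have := key 1 (-1) hg (by rwa [sub_neg_eq_add])
          rw [one_mul, sub_neg_eq_add] at this
          have h3 : o (g * h) - 1 ∉ P := fun h4 => hnot _ h4 this
          rw [if_neg h3]; simp [hg, hh]
        · have hg' := (hdich g).resolve_left hg
          have := key (-1) 1 (by rwa [sub_neg_eq_add]) hh
          rw [mul_one, sub_neg_eq_add] at this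
          have h3 : o (g * h) - 1 ∉ P := fun h4 => hnot _ h4 this
          rw [if_neg h3]; simp [hg, hh]
        · have hg' := (hdich g).resolve_left hg
          have hh' := (hdich h).resolve_left hh
          have := key (-1) (-1) (by rwa [sub_neg_eq_add]) (by rwa [sub_neg_eq_add])
          rw [neg_mul_neg, mul_one] at this
          rw [if_pos this]; simp [hg, hh] }
  have hχ : ∀ g, o g - (((χ g : ℤˣ) : ℤ) : RF F) ∈ P := by
    intro g
    by_cases hg : o g - 1 ∈ P
    · have : χ g = 1 := if_pos hg
      rw [this]; simpa using hg
    · have : χ g = -1 := if_neg hg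
      rw [this]; simpa using (hdich g).resolve_left hg
  have hχ2 : ∀ g, ((((χ g : ℤˣ) : ℤ) : RF F)) * ((((χ g : ℤˣ) : ℤ) : RF F)) = 1 := by
    intro g
    rcases Int.units_eq_one_or (χ g) with h | h <;> rw [h] <;> simp
  refine ⟨χ, fun hmem => ?_⟩
  have hall : ∀ x ∈ chiSub F χ M, ∃ r ∉ P, r • x = 0 := by
    intro x hx
    unfold chiSub at hx
    induction hx using Submodule.span_induction with
    | mem x hx =>
      obtain ⟨a, n, rfl⟩ := hx
      have hc : cls F a = o (sqc F a) := rfl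
      set e : RF F := ((((χ (sqc F a) : ℤˣ) : ℤ) : RF F)) with he
      have he2 : e * e = 1 := hχ2 _
      have hPa : o (sqc F a) - e ∈ P := hχ _
      refine ⟨o (sqc F a) + e, fun h => h2P ?_, ?_⟩
      · have h5 := P.mul_mem_left e (P.sub_mem h hPa)
        rw [show e * (o (sqc F a) + e - (o (sqc F a) - e)) = 2 * (e * e) by ring, he2,
          mul_one] at h5
        exact h5
      · rw [hc, ← Int.cast_smul_eq_zsmul (RF F), ← he, ← sub_smul, ← mul_smul,
          show (o (sqc F a) + e) * (o (sqc F a) - e) = 0 by linear_combination ho (sqc F a) - he2,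
          zero_smul]
    | zero => exact ⟨1, (Ideal.ne_top_iff_one P).1 hP.ne_top, smul_zero _⟩
    | add x y _ _ hx hy =>
      obtain ⟨r, hr, hrx⟩ := hx
      obtain ⟨s, hs, hsy⟩ := hy
      refine ⟨r * s, fun h => (hP.mem_or_mem h).elim hr hs, ?_⟩
      rw [smul_add, mul_smul r s y, hsy, smul_zero, add_zero, mul_comm, mul_smul, hrx, smul_zero]
    | smul a x _ hx =>
      obtain ⟨r, hr, hrx⟩ := hx
      exact ⟨r, hr, by rw [smul_comm, hrx, smul_zero]⟩
  obtain ⟨r, hr, hrm⟩ := hall m hmem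
  exact hr (hJP ((hJ r).2 hrm))

theorem aug_le_chiSub (M : Type) [AddCommGroup M] [Module (RF F) M] :
    augIdeal F • (⊤ : Submodule (RF F) M) ≤ chiSub F 1 M := by
  have key : ∀ (r : RF F) (x : M), r • x - (augRF F r) • x ∈ chiSub F 1 M := by
    intro r x
    induction r using MonoidAlgebra.induction_on with
    | of g =>
      obtain ⟨a, rfl⟩ := sqc_surj g
      refine Submodule.subset_span ⟨a, x, ?_⟩
      have : augRF F ((MonoidAlgebra.of ℤ (SqCl F)) (sqc F a)) = 1 := by
        simp [augRF]
      rw [this]; simp [cls]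
    | add a b ha hb =>
      rw [map_add, add_smul, add_smul, add_sub_add_comm]
      exact add_mem ha hb
    | smul n a ha =>
      have : augRF F (n • a) = n * augRF F a := by rw [map_zsmul, smul_eq_mul]
      rw [this, mul_smul, smul_assoc, ← smul_sub]
      exact zsmul_mem ha n
  rw [Submodule.smul_le]
  intro r hr x _
  have := key r x
  have h0 : augRF F r = 0 := hr
  rwa [h0, zero_smul, sub_zero] at this

/-- a character as a monoid-with-zero hom to the integers -/
noncomputable def chiF (χ : SqCl F →* ℤˣ) : F →*₀ ℤ where
  toFun x := if h : x ≠ 0 then ((χ (sqc F (U F x h)) : ℤˣ) : ℤ) else 0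
  map_zero' := by simp
  map_one' := by
    have : U F (1 : F) one_ne_zero = 1 := Units.ext rfl
    simp [this]
  map_mul' x y := by
    by_cases hx : x = 0
    · simp [hx]
    by_cases hy : y = 0
    · simp [hy]
    have : U F (x * y) (mul_ne_zero hx hy) = U F x hx * U F y hy := Units.ext rfl
    simp [hx, hy, this]

theorem chiF_unit (χ : SqCl F →* ℤˣ) (x : Fˣ) : chiF χ (x : F) = ((χ (sqc F x) : ℤˣ) : ℤ) := by
  have : U F (x : F) x.ne_zero = x := Units.ext rfl
  show (if h : (x : F) ≠ 0 then ((χ (sqc F (U F (x : F) h)) : ℤˣ) : ℤ) else 0) = _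
  rw [dif_pos x.ne_zero, this]

noncomputable def pF {N : Type} [AddCommGroup N] [Module (RF F) N] (ρ : RP' F →ₗ[RF F] N) (x : F) : N :=
  if h : x ≠ 0 then ρ (rp F (U F x h)) else 0

theorem pF_unit {N : Type} [AddCommGroup N] [Module (RF F) N] (ρ : RP' F →ₗ[RF F] N) (x : Fˣ) :
    pF ρ (x : F) = ρ (rp F x) := by
  have : U F (x : F) x.ne_zero = x := Units.ext rfl
  unfold pF
  rw [dif_pos x.ne_zero, this]

theorem rp_rel (w : FreeRP F) (hw : w ∈ ({gen F 1} ∪ ftRels F ∪ minusRels F ∪ invRels F : Set _)) :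
    (Submodule.Quotient.mk w : FreeRP F ⧸ Submodule.span (RF F)
    ({gen F 1} ∪ ftRels F ∪ minusRels F ∪ invRels F)) = 0 :=
  (Submodule.Quotient.mk_eq_zero _).2 (Submodule.subset_span hw)

theorem rp_one : rp F 1 = 0 := rp_rel _ (by simp)

theorem rp_inv (x : Fˣ) : rp F x⁻¹ + rp F x = 0 := rp_rel (gen F x⁻¹ + gen F x) (Or.inr ⟨x, rfl⟩)

theorem rp_minus (x : Fˣ) : cls F (-1) • rp F x - rp F x = 0 :=
  rp_rel (cls F (-1) • gen F x - gen F x) (Or.inl (Or.inr ⟨x, rfl⟩))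

theorem rp_ft (x y : Fˣ) (hx : (x : F) ≠ 1) (hy : (y : F) ≠ 1) :
    rp F x - rp F y + cls F x • rp F (y * x⁻¹)
    - cls F (U F ((x : F)⁻¹ - 1) (inv_sub_one_ne hx)) •
        rp F (U F ((1 - (x : F)⁻¹) / (1 - (y : F)⁻¹))
          (div_ne_zero (one_sub_inv_ne hx) (one_sub_inv_ne hy)))
    + cls F (U F (1 - (x : F)) (one_sub_ne hx)) •
        rp F (U F ((1 - (x : F)) / (1 - (y : F)))
          (div_ne_zero (one_sub_ne hx) (one_sub_ne hy))) = 0 :=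
  rp_rel (FT F x y hx hy) (Or.inl (Or.inl (Or.inr ⟨x, y, hx, hy, rfl⟩)))

theorem mkCore {N : Type} [AddCommGroup N] [Module (RF F) N] (ρ : RP' F →ₗ[RF F] N)
    (χ : SqCl F →* ℤˣ) (hN : ∀ (a : Fˣ) (n : N), cls F a • n = ((χ (sqc F a) : ℤˣ) : ℤ) • n)
    (tf : ∀ n : N, n + n = 0 → n = 0) (h1 : χ ≠ 1) (hm1 : χ (sqc F (-1)) = 1) :
    Core F N (chiF χ) (pF ρ) where
  sgn x hx := by
    have := chiF_unit χ (Units.mk0 x hx)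
    rw [Units.val_mk0] at this
    rw [this]
    rcases Int.units_eq_one_or (χ (sqc F (Units.mk0 x hx))) with h | h <;> rw [h] <;> simp
  neg1 := by
    have := chiF_unit χ (-1)
    rw [hm1] at this
    simpa using this
  nt := by
    by_contra hcon
    push Not at hcon
    refine h1 (MonoidHom.ext fun g => ?_)
    obtain ⟨a, rfl⟩ := sqc_surj g
    have := hcon a
    rw [chiF_unit] at this
    rcases Int.units_eq_one_or (χ (sqc F a)) with h | h
    · rw [h]; rfl
    · rw [h] at this; simp at this
  tf := tf
  one := by
    have := pF_unit ρ 1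
    rw [rp_one, map_zero] at this
    simpa using this
  inv x hx := by
    have e1 := pF_unit ρ (Units.mk0 x hx)
    have e2 := pF_unit ρ (Units.mk0 x hx)⁻¹
    rw [Units.val_inv_eq_inv_val, Units.val_mk0] at e2
    rw [Units.val_mk0] at e1
    rw [e1, e2, eq_neg_iff_add_eq_zero, ← map_add, rp_inv, map_zero]
  ft x y hx hy hx1 hy1 := by
    have h := congrArg ρ (rp_ft (Units.mk0 x hx) (Units.mk0 y hy) hx1 hy1)
    rw [map_zero] at h
    simp only [map_add, map_sub, map_smul, hN, ← pF_unit, ← chiF_unit] at h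
    simp only [Units.val_mul, Units.val_inv_eq_inv_val, Units.val_mk0, U] at h
    have hx1' : 1 - x ≠ 0 := sub_ne_zero.2 hx1.symm
    have hy1' : 1 - y ≠ 0 := sub_ne_zero.2 hy1.symm
    have s1 : chiF χ x * chiF χ x = 1 := by
      have := chiF_unit χ (Units.mk0 x hx)
      rw [Units.val_mk0] at this
      rw [this]
      rcases Int.units_eq_one_or (χ (sqc F (Units.mk0 x hx))) with h | h <;> rw [h] <;> simp
    have s2 : chiF χ (x⁻¹ - 1) = chiF χ x * chiF χ (1 - x) := by
      have := Core.m (chiF χ) (show x * (x⁻¹ - 1) = 1 - x by field_simp)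
      rw [← this, ← mul_assoc, s1, one_mul]
    have s3 : (1 - x⁻¹) / (1 - y⁻¹) = y * (1 - x) / (x * (1 - y)) := by
      rw [show 1 - x⁻¹ = -(1 - x) / x by field_simp; ring,
        show 1 - y⁻¹ = -(1 - y) / y by field_simp; ring]
      field_simp
    rw [s2, s3, ← div_eq_mul_inv] at h
    exact h

end Part3

section Part4
variable (k : Type) [Field k]

theorem rpK_ind
    (P : (M : ModuleCat.{0} (RF k)) → (kˣ → M) → Prop)
    (h2 : Nat.card k = 2 →
      (letI := trivMod k (ZMod 3); P (ModuleCat.of (RF k) (ZMod 3)) (fun _ => (0 : ZMod 3))))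
    (h3 : Nat.card k = 3 → P (ModuleCat.of (RF k) (RP'3 k))
      (fun u => if (u : k) = 1 then (0 : RP'3 k) else Submodule.Quotient.mk (1 : RF k)))
    (h4 : Nat.card k ≠ 2 → Nat.card k ≠ 3 → P (ModuleCat.of (RF k) (RP' k)) (rp k)) :
    P (RP'Kb k) (rpK k) := by
  have key : ∀ (M : ModuleCat.{0} (RF k)) (r : kˣ → M), RP'Kb k = M → HEq (rpK k) r → P M r →
      P (RP'Kb k) (rpK k) := by
    intro M r h hr hP
    subst h
    rw [eq_of_heq hr]; exact hP
  by_cases c2 : Nat.card k = 2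
  · refine key _ _ ?_ ?_ (h2 c2)
    · unfold RP'Kb; rw [if_pos c2]
    · unfold rpK; rw [dif_pos c2]; simp only [eq_mpr_eq_cast, id_eq, cast_cast]; exact cast_heq _ _
  by_cases c3 : Nat.card k = 3
  · refine key _ _ ?_ ?_ (h3 c3)
    · unfold RP'Kb; rw [if_neg c2, if_pos c3]
    · unfold rpK; rw [dif_neg c2, dif_pos c3]; simp only [eq_mpr_eq_cast, id_eq, cast_cast]; exact cast_heq _ _
  · refine key _ _ ?_ ?_ (h4 c2 c3)
    · unfold RP'Kb; rw [if_neg c2, if_neg c3]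
    · unfold rpK; rw [dif_neg c2, dif_neg c3]; simp only [eq_mpr_eq_cast, id_eq, cast_cast]; exact cast_heq _ _

variable {k}

theorem units_card2 (c2 : Nat.card k = 2) (u : kˣ) : u = 1 := by
  haveI : Finite k := Nat.finite_of_card_ne_zero (by omega)
  have : Nat.card kˣ = 1 := by rw [Nat.card_units, c2]
  exact (Nat.card_eq_one_iff_unique.1 this).1.elim _ _

theorem card2_smul (c2 : Nat.card k = 2) {N : Type} [AddCommGroup N] [Module (RF k) N]
    (r : RF k) (n : N) : r • n = augRF k r • n := by
  induction r using MonoidAlgebra.induction_on with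
  | of g =>
    obtain ⟨a, rfl⟩ := sqc_surj g
    rw [units_card2 c2 a, map_one, map_one, map_one, one_smul, one_smul]
  | add a b ha hb => rw [map_add, add_smul, add_smul, ha, hb]
  | smul m a ha =>
    have : augRF k (m • a) = m * augRF k a := by rw [map_zsmul, smul_eq_mul]
    rw [this, mul_smul, smul_assoc, ha]

theorem exists_unit (c2 : Nat.card k ≠ 2) : ∃ u : kˣ, (u : k) ≠ 1 := by
  by_contra h
  push Not at h
  apply c2
  have : (Set.univ : Set k) = {0, 1} := by
    ext x
    simp only [Set.mem_univ, Set.mem_insert_iff, Set.mem_singleton_iff, true_iff]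
    by_cases hx : x = 0
    · exact Or.inl hx
    · exact Or.inr (h (Units.mk0 x hx))
  rw [← Set.ncard_univ, this, Set.ncard_pair zero_ne_one]

theorem zmod3_ne {z : ZMod 3} (h : z ≠ 0) : z = 1 ∨ z = -1 := by
  revert z; decide

theorem exists_f {N : Type} [AddCommGroup N] [Module (RF k) N] (g : kˣ → N) (C : N)
    (hC3 : (3 : ℤ) • C = 0)
    (hg3 : Nat.card k = 3 → (∀ u, g u = 0) ∧ C = 0)
    (hg1 : g 1 = 0) (hginv : ∀ u, g u⁻¹ + g u = 0) (hgm : ∀ u, cls k (-1) • g u - g u = 0)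
    (hgC : ∀ (u : kˣ) (hu : (u : k) ≠ 1), g u + g (U k (1 - (u : k)) (one_sub_ne hu)) = C)
    (hgft : ∀ (x y : kˣ) (hx : (x : k) ≠ 1) (hy : (y : k) ≠ 1),
      g x - g y + cls k x • g (y * x⁻¹)
      - cls k (U k ((x : k)⁻¹ - 1) (inv_sub_one_ne hx)) •
        g (U k ((1 - (x : k)⁻¹) / (1 - (y : k)⁻¹))
          (div_ne_zero (one_sub_inv_ne hx) (one_sub_inv_ne hy)))
      + cls k (U k (1 - (x : k)) (one_sub_ne hx)) •
        g (U k ((1 - (x : k)) / (1 - (y : k)))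
          (div_ne_zero (one_sub_ne hx) (one_sub_ne hy))) = 0)
    (crk : RP'K k)
    (hcrk : ∀ (u : kˣ) (hu : (u : k) ≠ 1),
      crk = rpK _ u + rpK _ (U k (1 - (u : k)) (one_sub_ne hu)))
    (hcrk2 : Nat.card k = 2 → crk ≠ 0) :
    ∃ f : RP'K k →ₗ[RF k] N, (∀ u, f (rpK k u) = g u) ∧ f crk = C := by
  revert crk
  refine rpK_ind k (fun M r => ∀ (crk : M) (_ : ∀ (u : kˣ) (hu : (u : k) ≠ 1),
      crk = r u + r (U k (1 - (u : k)) (one_sub_ne hu))) (_ : Nat.card k = 2 → crk ≠ 0),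
      ∃ f : M →ₗ[RF k] N, (∀ u, f (r u) = g u) ∧ f crk = C) ?_ ?_ ?_
  · intro c2
    intro crk _ hne
    letI := trivMod k (ZMod 3)
    have key : ∀ c : N, (3 : ℤ) • c = 0 → ∃ f : ZMod 3 →ₗ[RF k] N, f 1 = c := by
      intro c hc
      let f0 : ZMod 3 →+ N := ZMod.lift 3 ⟨zmultiplesHom N c, by simpa using hc⟩
      refine ⟨{ f0 with map_smul' := ?_ }, ?_⟩
      · intro r z
        show f0 (r • z) = r • f0 z
        rw [card2_smul c2 r (f0 z), card2_smul c2 r z, map_zsmul]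
      · show f0 1 = c
        have := ZMod.lift_coe 3 ⟨zmultiplesHom N c, by simpa using hc⟩ 1
        simpa [f0] using this
    have hg0 : ∀ u, g u = 0 := fun u => by rw [units_card2 c2 u, hg1]
    change ZMod 3 at crk
    rcases zmod3_ne (z := crk) (hne c2) with h | h
    · obtain ⟨f, hf⟩ := key C hC3
      exact ⟨f, fun u => (map_zero f).trans (hg0 u).symm, by rw [h]; exact hf⟩
    · obtain ⟨f, hf⟩ := key (-C) (by rw [smul_neg, hC3, neg_zero])
      refine ⟨f, fun u => (map_zero f).trans (hg0 u).symm, ?_⟩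
      rw [h]
      refine (map_neg f (1 : ZMod 3)).trans ?_
      rw [hf, neg_neg]
  · intro c3 crk _ _
    exact ⟨0, fun u => by rw [(hg3 c3).1]; rfl, by rw [(hg3 c3).2]; rfl⟩
  · intro c2 c3 crk hc _
    let L : FreeRP k →ₗ[RF k] N := Finsupp.linearCombination (RF k) g
    have hL : ∀ u, L (gen k u) = g u := fun u => by
      show Finsupp.linearCombination (RF k) g (Finsupp.single u 1) = g u
      rw [Finsupp.linearCombination_single, one_smul]
    let f : RP' k →ₗ[RF k] N := Submodule.liftQ _ L (by
      rw [Submodule.span_le]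
      rintro w (((hw | ⟨x, y, hx, hy, rfl⟩) | ⟨x, rfl⟩) | ⟨x, rfl⟩)
      · rw [Set.mem_singleton_iff] at hw
        rw [hw, SetLike.mem_coe, LinearMap.mem_ker, hL, hg1]
      · rw [SetLike.mem_coe, LinearMap.mem_ker]
        unfold FT
        simp only [map_add, map_sub, map_smul, hL]
        exact hgft x y hx hy
      · rw [SetLike.mem_coe, LinearMap.mem_ker]
        simp only [map_sub, map_smul, hL]
        exact hgm x
      · rw [SetLike.mem_coe, LinearMap.mem_ker]
        simp only [map_add, hL]
        exact hginv x)
    have hf : ∀ u, f (rp k u) = g u := fun u => hL u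
    obtain ⟨u, hu⟩ := exists_unit c2
    refine ⟨f, hf, ?_⟩
    rw [hc u hu, ← hgC u hu, ← hf, ← hf]
    exact map_add f _ _

theorem span_rpK (crk : RP'K k) (hcrk2 : Nat.card k = 2 → crk ≠ 0) :
    Submodule.span (RF k) (Set.range (rpK k) ∪ {crk}) = ⊤ := by
  revert crk
  refine rpK_ind k (fun M r => ∀ (crk : M) (_ : Nat.card k = 2 → crk ≠ 0),
    Submodule.span (RF k) (Set.range r ∪ {crk}) = ⊤) ?_ ?_ ?_
  · intro c2 crk hne
    letI := trivMod k (ZMod 3)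
    rw [eq_top_iff]
    intro z _
    have hmem : crk ∈ Submodule.span (RF k) (Set.range (fun _ : kˣ => (0 : ZMod 3)) ∪ {crk}) :=
      Submodule.subset_span (Or.inr rfl)
    have hz : ∃ n : ℤ, z = n • crk := by
      have : ∀ (z c : ZMod 3), c ≠ 0 → ∃ n : ℤ, z = n • c := by
        intro z c hc
        obtain ⟨n, hn⟩ := ZMod.intCast_surjective z
        rcases zmod3_ne hc with h | h
        · exact ⟨n, by rw [h, ← hn]; simp⟩
        · exact ⟨-n, by rw [h, ← hn]; simp⟩
      exact this z crk (hne c2)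
    obtain ⟨n, rfl⟩ := hz
    exact zsmul_mem hmem n
  · intro c3 crk _
    rw [eq_top_iff]
    intro z _
    obtain ⟨u, hu⟩ := exists_unit (k := k) (by omega)
    obtain ⟨r, rfl⟩ := Submodule.Quotient.mk_surjective _ z
    have : (Submodule.Quotient.mk r : RF k ⧸ Submodule.span (RF k)
      {(2 : RF k) * (1 + cls k (-1)), cls k (-1) - 1, 1 + cls k (-1)}) =
      r • Submodule.Quotient.mk (1 : RF k) := by
      rw [← Submodule.Quotient.mk_smul, smul_eq_mul, mul_one]
    refine Eq.subst (motive := fun t => t ∈ _) this.symm (Submodule.smul_mem _ r (Submodule.subset_span (Or.inl ⟨u, ?_⟩)))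
    exact if_neg hu
  · intro c2 c3 crk _
    rw [eq_top_iff]
    intro z _
    let q : FreeRP k →ₗ[RF k] RP' k := Submodule.mkQ _
    obtain ⟨w, rfl⟩ : ∃ w, q w = z := Submodule.mkQ_surjective _ z
    have : ∀ w : FreeRP k, q w ∈ Submodule.span (RF k) (Set.range (rp k) ∪ {crk}) := by
      intro w
      induction w using Finsupp.induction_linear with
      | zero => rw [map_zero]; exact zero_mem _
      | add a b ha hb => rw [map_add]; exact add_mem ha hb
      | single u r =>
        have e : (Finsupp.single u r : FreeRP k) = r • gen k u := by
          simp [gen]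
        rw [e, map_smul]
        exact Submodule.smul_mem _ _ (Submodule.subset_span (Or.inl ⟨u, rfl⟩))
    exact this w

end Part4

section Part5

section Loc
variable (F : Type) [Field F] {M : Type} [AddCommGroup M] [Module (RF F) M]

noncomputable def toLoc2L : M →ₗ[RF F] Loc2 F M :=
  LocalizedModule.mkLinearMap (Submonoid.powers (2 : RF F)) M

theorem toLoc2L_apply (m : M) : toLoc2L F m = toLoc2 F m := rfl

instance toLoc2L_isLoc : IsLocalizedModule (Submonoid.powers (2 : RF F)) (toLoc2L F (M := M)) :=
  inferInstanceAs (IsLocalizedModule (Submonoid.powers (2 : RF F))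
    (LocalizedModule.mkLinearMap (Submonoid.powers (2 : RF F)) M))

theorem loc2_bij : Function.Bijective (fun x : Loc2 F M => x + x) := by
  have h := IsLocalizedModule.map_units (S := Submonoid.powers (2 : RF F)) (toLoc2L F (M := M))
    ⟨2, Submonoid.mem_powers _⟩
  rw [Module.End.isUnit_iff] at h
  have e : (fun x : Loc2 F M => x + x) = fun x => (2 : RF F) • x := by
    funext x; rw [two_smul]
  rw [e]
  exact h

theorem loc2_surj (x : Loc2 F M) : ∃ (j : ℕ) (z : M), (2 : RF F) ^ j • x = toLoc2 F z := by
  obtain ⟨⟨z, ⟨s, j, rfl⟩⟩, h⟩ :=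
    IsLocalizedModule.surj (Submonoid.powers (2 : RF F)) (toLoc2L F (M := M)) x
  exact ⟨j, z, h⟩

theorem loc2_lift {N : Type} [AddCommGroup N] [Module (RF F) N]
    (hN : Function.Bijective (fun x : N => x + x)) (f : M →ₗ[RF F] N) :
    ∃ f' : Loc2 F M →ₗ[RF F] N, ∀ m, f' (toLoc2 F m) = f m := by
  have h2 : IsUnit (algebraMap (RF F) (Module.End (RF F) N) 2) := by
    rw [Module.End.isUnit_iff]
    have e : (fun x : N => x + x) = fun x => (2 : RF F) • x := by
      funext x; rw [two_smul]
    rw [e] at hN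
    exact hN
  refine ⟨IsLocalizedModule.lift (Submonoid.powers (2 : RF F)) (toLoc2L F (M := M)) f ?_, ?_⟩
  · rintro ⟨_, j, rfl⟩
    show IsUnit (algebraMap (RF F) (Module.End (RF F) N) (2 ^ j))
    rw [map_pow]
    exact h2.pow j
  · intro m
    exact IsLocalizedModule.lift_apply (Submonoid.powers (2 : RF F)) (toLoc2L F (M := M)) f _ m

end Loc

section Chi
variable {F : Type} [Field F] {M : Type} [AddCommGroup M] [Module (RF F) M] (χ : SqCl F →* ℤˣ)

noncomputable def mkChiL : M →ₗ[RF F] ChiQuot F χ M := Submodule.mkQ (chiSub F χ M)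

theorem mkChiL_surj : Function.Surjective (mkChiL χ (M := M)) := Submodule.mkQ_surjective _

theorem mkChiL_eq_zero (m : M) : mkChiL χ m = 0 ↔ m ∈ chiSub F χ M :=
  Submodule.Quotient.mk_eq_zero _

theorem chi_act (a : Fˣ) (n : ChiQuot F χ M) :
    cls F a • n = ((χ (sqc F a) : ℤˣ) : ℤ) • n := by
  obtain ⟨m, rfl⟩ := mkChiL_surj χ n
  rw [← sub_eq_zero, ← map_smul, ← map_zsmul, ← map_sub, mkChiL_eq_zero]
  exact Submodule.subset_span ⟨a, m, rfl⟩

theorem chi_bij (hM : Function.Bijective (fun x : M => x + x)) :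
    Function.Bijective (fun x : ChiQuot F χ M => x + x) := by
  constructor
  · have key : ∀ w ∈ chiSub F χ M, ∃ w' ∈ chiSub F χ M, w' + w' = w := by
      intro w hw
      induction hw using Submodule.span_induction with
      | mem x hx =>
        obtain ⟨a, m, rfl⟩ := hx
        obtain ⟨m', rfl⟩ := hM.2 m
        refine ⟨_, Submodule.subset_span ⟨a, m', rfl⟩, ?_⟩
        simp only [smul_add]; abel
      | zero => exact ⟨0, zero_mem _, add_zero _⟩
      | add x y _ _ hx hy =>
        obtain ⟨x', hx, rfl⟩ := hx
        obtain ⟨y', hy, rfl⟩ := hy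
        exact ⟨_, add_mem hx hy, by abel⟩
      | smul r x _ hx =>
        obtain ⟨x', hx, rfl⟩ := hx
        exact ⟨_, Submodule.smul_mem _ r hx, by rw [smul_add]⟩
    intro n n' h
    obtain ⟨m, rfl⟩ := mkChiL_surj χ n
    obtain ⟨m', rfl⟩ := mkChiL_surj χ n'
    rw [← sub_eq_zero, ← map_sub, mkChiL_eq_zero]
    have h' : mkChiL χ ((m - m') + (m - m')) = 0 := by
      have h : mkChiL χ m + mkChiL χ m = mkChiL χ m' + mkChiL χ m' := h
      rw [map_add, map_sub, ← add_sub_add_comm, h, sub_self]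
    rw [mkChiL_eq_zero] at h'
    obtain ⟨w, hw, h3⟩ := key _ h'
    rw [← hM.1 h3]; exact hw
  · intro n
    obtain ⟨m, rfl⟩ := mkChiL_surj χ n
    obtain ⟨m', rfl⟩ := hM.2 m
    exact ⟨mkChiL χ m', (map_add _ _ _).symm⟩
end Chi

section Ind
variable (F : Type) [Field F] {Γ₀ : Type} [LinearOrderedCommGroupWithZero Γ₀]
variable (v : Valuation F Γ₀) {M : Type} [AddCommGroup M] [Module (RF (Resk F v)) M]

theorem ind_ind (P : IndMod F v M → Prop) (h0 : P 0) (h1 : ∀ r m, P (indE F v M r m))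
    (ha : ∀ x y, P x → P y → P (x + y)) (x : IndMod F v M) : P x := by
  letI : Module (ZU F v) (RF F) := Module.compHom _ (zuF F v)
  letI : Module (ZU F v) M := Module.compHom _ (zuK F v)
  exact TensorProduct.induction_on (R := ZU F v) (M := RF F) (N := M) (motive := P) x h0 h1 ha

theorem smul_indE (r s : RF F) (m : M) : r • indE F v M s m = indE F v M (r * s) m := rfl

theorem indE_add (r : RF F) (m n : M) : indE F v M r (m + n) = indE F v M r m + indE F v M r n := by
  letI : Module (ZU F v) (RF F) := Module.compHom _ (zuF F v)
  letI : Module (ZU F v) M := Module.compHom _ (zuK F v)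
  exact TensorProduct.tmul_add _ _ _

theorem indE_smul (r : RF F) (z : ZU F v) (m : M) :
    indE F v M r (zuK F v z • m) = indE F v M (zuF F v z * r) m := by
  letI : Module (ZU F v) (RF F) := Module.compHom _ (zuF F v)
  letI : Module (ZU F v) M := Module.compHom _ (zuK F v)
  exact TensorProduct.tmul_smul (R := ZU F v) z r m

theorem zuK_single (u : Uv F v) : zuK F v (MonoidAlgebra.of ℤ (Uv F v) u) =
    cls (Resk F v) (uvToResUnits F v u) := by
  exact MonoidAlgebra.mapDomain_single

theorem zuF_single (u : Uv F v) : zuF F v (MonoidAlgebra.of ℤ (Uv F v) u) =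
    cls F (uvToUnits F v u) := by
  exact MonoidAlgebra.mapDomain_single

theorem ind_lift {N : Type} [AddCommGroup N] [Module (RF F) N] [Module (RF (Resk F v)) N]
    (hc : ∀ (u : Uv F v) (n : N), cls F (uvToUnits F v u) • n =
      cls (Resk F v) (uvToResUnits F v u) • n)
    (f : M →ₗ[RF (Resk F v)] N) :
    ∃ T : IndMod F v M →ₗ[RF F] N, ∀ r m, T (indE F v M r m) = r • f m := by
  have hz : ∀ (z : ZU F v) (n : N), zuF F v z • n = zuK F v z • n := by
    intro z n
    induction z using MonoidAlgebra.induction_on with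
    | of g => 
      have := hc g n
      rw [← zuF_single, ← zuK_single] at this
      exact this
    | add a b ha hb => 
      have e1 := map_add (zuF F v) a b
      have e2 := map_add (zuK F v) a b
      refine (congrArg (· • n) e1).trans (Eq.trans ?_ (congrArg (· • n) e2).symm)
      simp only [add_smul]
      exact congrArg₂ (· + ·) ha hb
    | smul m a ha => 
      have e1 := map_zsmul (zuF F v) m a
      have e2 := map_zsmul (zuK F v) m a
      refine (congrArg (· • n) e1).trans (Eq.trans ?_ (congrArg (· • n) e2).symm)
      simp only [smul_assoc]
      exact congrArg (m • ·) ha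
  letI : Module (ZU F v) (RF F) := Module.compHom _ (zuF F v)
  letI : Module (ZU F v) M := Module.compHom _ (zuK F v)
  let B : RF F →+ M →+ N :=
    AddMonoidHom.mk' (fun r => AddMonoidHom.mk' (fun m => r • f m)
      (fun a b => by rw [map_add, smul_add]))
      (fun a b => by ext m; exact add_smul a b (f m))
  let T0 : IndMod F v M →+ N := TensorProduct.liftAddHom (R := ZU F v) (M := RF F) (N := M) B
    (by
      intro z r m
      show (zuF F v z * r) • f m = r • f (zuK F v z • m)
      rw [map_smul, ← hz, mul_comm, mul_smul])
  have hT : ∀ r m, T0 (indE F v M r m) = r • f m := fun r m => rfl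
  refine ⟨{ T0 with map_smul' := ?_ }, hT⟩
  intro r x
  show T0 (r • x) = r • T0 x
  induction x using ind_ind with
  | h0 => rw [smul_zero, map_zero, smul_zero]
  | h1 s m => rw [smul_indE, hT, hT, mul_smul]
  | ha x y hx hy => rw [smul_add, map_add, map_add, smul_add, hx, hy]

end Ind
end Part5

section Part6
variable {F : Type} [Field F] {Γ₀ : Type} [LinearOrderedCommGroupWithZero Γ₀]
variable (v : Valuation F Γ₀)

noncomputable def resT (a : F) : Resk F v :=
  if h : v a ≤ 1 then IsLocalRing.residue (↥v.valuationSubring) ⟨a, h⟩ else 0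

theorem resT_of {a : F} (h : v a ≤ 1) :
    resT v a = IsLocalRing.residue (↥v.valuationSubring) ⟨a, h⟩ := dif_pos h

theorem resT_surj (w : Resk F v) : ∃ a, v a ≤ 1 ∧ resT v a = w := by
  obtain ⟨⟨a, ha⟩, rfl⟩ := IsLocalRing.residue_surjective (R := ↥v.valuationSubring) w
  exact ⟨a, ha, resT_of v ha⟩

theorem resT_zero_iff {a : F} (h : v a ≤ 1) : resT v a = 0 ↔ v a < 1 := by
  rw [resT_of v h]
  refine (IsLocalRing.residue_eq_zero_iff _).trans ?_
  rw [IsLocalRing.mem_maximalIdeal, mem_nonunits_iff]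
  have : IsUnit (⟨a, h⟩ : v.valuationSubring) ↔ v a = 1 := by
    constructor
    · rintro ⟨u, hu⟩
      have h1 : v ((u⁻¹ : (v.valuationSubring)ˣ) : v.valuationSubring) ≤ 1 := (u⁻¹).1.2
      have h2 : ((u : v.valuationSubring) : F) * ((u⁻¹ : (v.valuationSubring)ˣ) : v.valuationSubring) = 1 := by
        have := congrArg Subtype.val (Units.mul_inv u)
        exact this
      rw [hu] at h2
      have h3 := congrArg v h2
      rw [map_mul, map_one] at h3
      refine le_antisymm h ?_
      calc (1 : Γ₀) = _ := h3.symm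
        _ ≤ v a * 1 := mul_le_mul_right h1 _
        _ = v a := mul_one _
    · intro h1
      have h0 : a ≠ 0 := by rintro rfl; simp at h1
      exact ⟨unitOfVal F v (Units.mk0 a h0) h1, rfl⟩
  rw [this]
  exact ⟨fun h' => lt_of_le_of_ne h h', fun h' => h'.ne⟩

theorem resT_add {a b : F} (ha : v a ≤ 1) (hb : v b ≤ 1) : resT v (a + b) = resT v a + resT v b := by
  have h : v (a + b) ≤ 1 := v.map_add_le ha hb
  rw [resT_of v ha, resT_of v hb, resT_of v h]
  exact map_add (IsLocalRing.residue (↥v.valuationSubring)) ⟨a, ha⟩ ⟨b, hb⟩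

theorem resT_mul {a b : F} (ha : v a ≤ 1) (hb : v b ≤ 1) : resT v (a * b) = resT v a * resT v b := by
  have h : v (a * b) ≤ 1 := by rw [map_mul]; exact mul_le_one' ha hb
  rw [resT_of v ha, resT_of v hb, resT_of v h]
  exact map_mul (IsLocalRing.residue (↥v.valuationSubring)) ⟨a, ha⟩ ⟨b, hb⟩

theorem resT_one : resT v 1 = 1 := by
  rw [resT_of v (le_of_eq (map_one v))]
  exact map_one (IsLocalRing.residue (↥v.valuationSubring))

theorem resT_neg {a : F} (ha : v a ≤ 1) : resT v (-a) = -resT v a := by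
  have h : v (-a) ≤ 1 := by rwa [Valuation.map_neg]
  rw [resT_of v ha, resT_of v h]
  exact map_neg (IsLocalRing.residue (↥v.valuationSubring)) ⟨a, ha⟩

theorem resT_sub {a b : F} (ha : v a ≤ 1) (hb : v b ≤ 1) : resT v (a - b) = resT v a - resT v b := by
  rw [sub_eq_add_neg, resT_add v ha (by rwa [Valuation.map_neg]), resT_neg v hb, sub_eq_add_neg]

theorem resT_div {a b : F} (ha : v a ≤ 1) (hb : v b = 1) : resT v (a / b) = resT v a / resT v b := by
  have h0 : b ≠ 0 := by rintro rfl; simp at hb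
  have h1 : resT v b ≠ 0 := fun h => ((resT_zero_iff v hb.le).1 h).ne hb
  rw [eq_div_iff h1, ← resT_mul v (by rw [map_div₀, hb, div_one]; exact ha) hb.le, div_mul_cancel₀ _ h0]

theorem resUnit_val (x : Fˣ) (hx : v (x : F) = 1) : ((resUnit F v x hx : (Resk F v)ˣ) : Resk F v) = resT v x :=
  (resT_of v hx.le).symm

theorem res_unit_lift (w : (Resk F v)ˣ) : ∃ a : F, v a = 1 ∧ (w : Resk F v) = resT v a := by
  obtain ⟨a, ha, h⟩ := resT_surj v (w : Resk F v)
  refine ⟨a, ?_, h.symm⟩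
  by_contra h1
  exact w.ne_zero (h ▸ (resT_zero_iff v ha).2 (lt_of_le_of_ne ha h1))

theorem uvRes_surj : Function.Surjective (uvToResUnits F v) := by
  intro w
  obtain ⟨a, ha, h⟩ := res_unit_lift v w
  have h0 : a ≠ 0 := by rintro rfl; simp at ha
  exact ⟨unitOfVal F v (Units.mk0 a h0) ha, Units.ext ((resUnit_val v (Units.mk0 a h0) ha).trans h.symm)⟩

theorem uv_val (u : Uv F v) : v (uvToUnits F v u : F) = 1 ∧
    ((uvToResUnits F v u : (Resk F v)ˣ) : Resk F v) = resT v (uvToUnits F v u : F) := by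
  have hle : v (uvToUnits F v u : F) ≤ 1 := (show (v.valuationSubring)ˣ from u).1.2
  have h : ((uvToResUnits F v u : (Resk F v)ˣ) : Resk F v) = resT v (uvToUnits F v u : F) :=
    (resT_of v hle).symm
  refine ⟨?_, h⟩
  by_contra h1
  exact (uvToResUnits F v u).ne_zero (h ▸ (resT_zero_iff v hle).2 (lt_of_le_of_ne hle h1))

theorem chi_bar (χ : SqCl F →* ℤˣ) (ht : ∀ t : Fˣ, v ((t : F) - 1) < 1 → χ (sqc F t) = 1) :
    ∃ χ' : SqCl (Resk F v) →* ℤˣ, ∀ u : Uv F v,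
      χ' (sqc _ (uvToResUnits F v u)) = χ (sqc F (uvToUnits F v u)) := by
  let φ : Uv F v →* ℤˣ := (χ.comp (sqc F)).comp (uvToUnits F v)
  have hk : (uvToResUnits F v).ker ≤ φ.ker := by
    intro u hu
    rw [MonoidHom.mem_ker] at hu ⊢
    obtain ⟨h1, h2⟩ := uv_val v u
    apply ht
    rw [hu, Units.val_one, ← resT_one v, eq_comm, ← sub_eq_zero,
      ← resT_sub v h1.le (map_one v).le, resT_zero_iff] at h2
    · exact h2
    · exact v.map_sub_le h1.le (map_one v).le
  let ψ : (Resk F v)ˣ →* ℤˣ := (uvToResUnits F v).liftOfSurjective (uvRes_surj v) ⟨φ, hk⟩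
  have hψ : ∀ u, ψ (uvToResUnits F v u) = φ u := fun u =>
    MonoidHom.liftOfRightInverse_comp_apply (uvToResUnits F v) _
      (Function.rightInverse_surjInv (uvRes_surj v)) ⟨φ, hk⟩ u
  refine ⟨QuotientGroup.lift _ ψ ?_, fun u => hψ u⟩
  rintro _ ⟨y, rfl⟩
  show ψ (y ^ 2) = 1
  rw [map_pow, pow_two, Int.units_mul_self]

theorem sq_one_of_card3 {k : Type} [Field k] (c3 : Nat.card k = 3) (u : kˣ) : u * u = 1 := by
  have : Finite k := Nat.finite_of_card_ne_zero (by omega)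
  have h : Nat.card kˣ = 2 := by rw [Nat.card_units, c3]
  rw [← pow_two, ← h, pow_card_eq_one']

end Part6

section Part7
variable {F : Type} [Field F]

theorem rp_ext {N : Type} [AddCommGroup N] [Module (RF F) N] (f g : RP' F →ₗ[RF F] N)
    (h : ∀ x, f (rp F x) = g (rp F x)) : f = g := by
  refine Submodule.linearMap_qext _ ?_
  refine Finsupp.lhom_ext' fun x => LinearMap.ext_ring ?_
  exact h x

theorem chiF_of (χ : SqCl F →* ℤˣ) {a : F} (h : a ≠ 0) :
    chiF χ a = ((χ (sqc F (Units.mk0 a h)) : ℤˣ) : ℤ) := chiF_unit χ (Units.mk0 a h)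

noncomputable def chiRing {k : Type} [Field k] (χ : SqCl k →* ℤˣ) : RF k →+* ℤ :=
  ((MonoidAlgebra.lift ℤ ℤ (SqCl k)) ((Units.coeHom ℤ).comp χ)).toRingHom

theorem chiRing_cls {k : Type} [Field k] (χ : SqCl k →* ℤˣ) (w : kˣ) :
    chiRing χ (cls k w) = ((χ (sqc k w) : ℤˣ) : ℤ) := by
  show (MonoidAlgebra.lift ℤ ℤ (SqCl k)) ((Units.coeHom ℤ).comp χ) (MonoidAlgebra.of ℤ (SqCl k) (sqc k w)) = _
  rw [MonoidAlgebra.lift_of]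
  rfl

theorem caseB_final {N : Type} [AddCommGroup N] [Module (RF F) N]
    (v : Valuation F (WithZero (Multiplicative ℤ)))
    (bij : Function.Bijective (fun x : N => x + x))
    (ρ : RP' F →ₗ[RF F] N) (χ : SqCl F →* ℤˣ)
    (hN : ∀ (a : Fˣ) (n : N), cls F a • n = ((χ (sqc F a) : ℤˣ) : ℤ) • n)
    (H : Core F N (chiF χ) (pF ρ)) {C : N} (hC : Core.IsC (pF ρ) C) (hC3 : (3 : ℤ) • C = 0)
    {ϖ : F} (hϖ0 : ϖ ≠ 0) (hϖ : v ϖ < 1)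
    (hu : ∀ x, v x < 1 → v x ≤ v ϖ) (ht : ∀ t, v (t - 1) < 1 → chiF χ t = 1)
    (crk : RP'K (Resk F v))
    (hcrk : ∀ (u : (Resk F v)ˣ) (hu : (u : Resk F v) ≠ 1),
      crk = rpK _ u + rpK _ (U (Resk F v) (1 - (u : Resk F v)) (one_sub_ne hu)))
    (hcrk2 : Nat.card (Resk F v) = 2 → crk ≠ 0)
    (σ : RP' F →ₗ[RF F] IndMod F v (Loc2 (Resk F v) (RP'K (Resk F v))))
    (hσ1 : ∀ (x : Fˣ) (hx : v (x : F) = 1),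
      σ (rp F x) = indE F v _ 1 (toLoc2 (Resk F v) (rpK _ (resUnit F v x hx))))
    (hσpos : ∀ x : Fˣ, v (x : F) < 1 →
      σ (rp F x) = indE F v _ 1 (toLoc2 (Resk F v) crk))
    (hσneg : ∀ x : Fˣ, 1 < v (x : F) →
      σ (rp F x) = -indE F v _ 1 (toLoc2 (Resk F v) crk)) :
    ∀ z, σ z = 0 → ρ z = 0 := by
  have hlow : ∀ x, x ≠ 0 → v x < 1 → pF ρ x = C := fun x h0 h => H.caseB_low hC v hϖ0 hϖ hu ht h0 h
  have ne0 : ∀ {a : F}, v a = 1 → a ≠ 0 := by rintro _ h rfl; simp at h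
  have ht' : ∀ t : Fˣ, v ((t : F) - 1) < 1 → χ (sqc F t) = 1 := by
    intro t h
    have := ht t h
    rw [chiF_unit] at this
    exact Units.ext this
  obtain ⟨χ', hχ'⟩ := chi_bar v χ ht'
  letI : Module (RF (Resk F v)) N := Module.compHom N (chiRing χ')
  have hact : ∀ (w : (Resk F v)ˣ) (n : N), cls (Resk F v) w • n = ((χ' (sqc _ w) : ℤˣ) : ℤ) • n := by
    intro w n
    rw [← chiRing_cls]; rfl
  have hcl : ∀ (w : (Resk F v)ˣ) (a : F) (n : N), v a = 1 → (w : Resk F v) = resT v a →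
      cls (Resk F v) w • n = chiF χ a • n := by
    intro w a n ha hw
    have e : w = uvToResUnits F v (unitOfVal F v (Units.mk0 a (ne0 ha)) ha) := by
      apply Units.ext
      rw [hw]
      exact (resUnit_val v (Units.mk0 a (ne0 ha)) ha).symm
    rw [hact, e, hχ', chiF_of χ (ne0 ha)]
    rfl
  choose l hl1 hl2 using res_unit_lift v
  have hg : ∀ (w : (Resk F v)ˣ) (a : F), v a = 1 → (w : Resk F v) = resT v a →
      pF ρ (l w) = pF ρ a := by
    intro w a ha hw
    have h1 : v (a / l w) ≤ 1 := by rw [map_div₀, ha, hl1, div_one]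
    have h := H.caseB_unit hC v hϖ0 hϖ hu ht (s := l w) (t := a / l w) (hl1 w) (by
      rw [← resT_zero_iff v (v.map_sub_le h1 (map_one v).le), resT_sub v h1 (map_one v).le,
        resT_div v ha.le (hl1 w), ← hl2, ← hw, resT_one, div_self w.ne_zero, sub_self])
    rw [mul_div_cancel₀ _ (ne0 (hl1 w))] at h
    exact h.symm
  have hl0 : ∀ w, l w ≠ 0 := fun w => ne0 (hl1 w)
  have hne1 : ∀ w : (Resk F v)ˣ, (w : Resk F v) ≠ 1 → v (1 - l w) = 1 := by
    intro w hw
    have h1 : v (1 - l w) ≤ 1 := v.map_sub_le (map_one v).le (hl1 w).le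
    by_contra h
    have := (resT_zero_iff v h1).2 (lt_of_le_of_ne h1 h)
    rw [resT_sub v (map_one v).le (hl1 w).le, resT_one, ← hl2, sub_eq_zero] at this
    exact hw this.symm
  have hr1 : ∀ w, resT v (1 - l w) = 1 - (w : Resk F v) := fun w => by
    rw [resT_sub v (map_one v).le (hl1 w).le, resT_one, ← hl2]
  have hl1' : ∀ w : (Resk F v)ˣ, (w : Resk F v) ≠ 1 → l w ≠ 1 := by
    intro w hw h
    have := hne1 w hw
    rw [h, sub_self, map_zero] at this
    exact zero_ne_one this
  have hginv : ∀ u : (Resk F v)ˣ, pF ρ (l u⁻¹) + pF ρ (l u) = 0 := by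
    intro u
    have e : ((u⁻¹ : (Resk F v)ˣ) : Resk F v) = resT v (1 / l u) := by
      rw [resT_div v (map_one v).le (hl1 u), ← hl2, resT_one, Units.val_inv_eq_inv_val, one_div]
    rw [hg u⁻¹ (1 / l u) (by rw [map_div₀, hl1, map_one, div_one]) e, one_div, H.inv _ (hl0 u),
      neg_add_cancel]
  have hgC : ∀ (u : (Resk F v)ˣ) (hu : (u : Resk F v) ≠ 1),
      pF ρ (l u) + pF ρ (l (U (Resk F v) (1 - (u : Resk F v)) (one_sub_ne hu))) = C := by
    intro u hu
    rw [hg (U (Resk F v) (1 - (u : Resk F v)) (one_sub_ne hu)) (1 - l u) (hne1 u hu) (hr1 u).symm, hC _ (hl0 u) (hl1' u hu)]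
  obtain ⟨f, hf1, hf2⟩ := exists_f (k := Resk F v) (N := N) (fun w => pF ρ (l w)) C hC3
    (by
      intro c3
      have h0 : ∀ u : (Resk F v)ˣ, pF ρ (l u) = 0 := by
        intro u
        have h := hginv u
        rw [inv_eq_of_mul_eq_one_left (sq_one_of_card3 c3 u)] at h
        exact H.tf _ h
      refine ⟨h0, ?_⟩
      obtain ⟨u, hu⟩ := exists_unit (k := Resk F v) (by omega)
      rw [← hgC u hu, h0, h0, add_zero])
    (by
      show pF ρ (l 1) = 0
      rw [hg 1 1 (map_one v) (by rw [resT_one]; rfl), H.one])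
    hginv
    (by
      intro u
      rw [hcl (-1) (-1) _ (by rw [Valuation.map_neg, map_one])
        (by rw [resT_neg v (map_one v).le, resT_one]; rfl), H.neg1, one_smul, sub_self])
    hgC
    (by
      intro x y hx hy
      have h := H.ft (l x) (l y) (hl0 x) (hl0 y) (hl1' x hx) (hl1' y hy)
      have hx1 := hne1 x hx
      have hy1 := hne1 y hy
      have nx := one_sub_ne hx
      have ny := one_sub_ne hy
      have ex : (x : Resk F v) ≠ 0 := x.ne_zero
      have ey : (y : Resk F v) ≠ 0 := y.ne_zero
      have e0 := hcl x (l x) (pF ρ (l y / l x)) (hl1 x) (hl2 x)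
      have e1 : pF ρ (l (y * x⁻¹)) = pF ρ (l y / l x) := hg _ _
        (by rw [map_div₀, hl1, hl1, div_one])
        (by rw [resT_div v (hl1 y).le (hl1 x), ← hl2, ← hl2, Units.val_mul,
              Units.val_inv_eq_inv_val, div_eq_mul_inv])
      have e2 : pF ρ (l (U (Resk F v) ((1 - (x : Resk F v)) / (1 - (y : Resk F v)))
          (div_ne_zero (one_sub_ne hx) (one_sub_ne hy)))) = pF ρ ((1 - l x) / (1 - l y)) := hg _ _
        (by rw [map_div₀, hx1, hy1, div_one])
        (by rw [resT_div v hx1.le hy1, hr1, hr1]; rfl)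
      have vm : ∀ {a b : F}, v a = 1 → v b = 1 → v (a * b) = 1 := by
        intro a b ha hb; rw [map_mul, ha, hb, one_mul]
      have e3 : pF ρ (l (U (Resk F v) ((1 - (x : Resk F v)⁻¹) / (1 - (y : Resk F v)⁻¹))
          (div_ne_zero (one_sub_inv_ne hx) (one_sub_inv_ne hy)))) =
          pF ρ (l y * (1 - l x) / (l x * (1 - l y))) := hg _ _
        (by rw [map_div₀, vm (hl1 y) hx1, vm (hl1 x) hy1, div_one])
        (by
          rw [resT_div v (vm (hl1 y) hx1).le (vm (hl1 x) hy1), resT_mul v (hl1 y).le hx1.le,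
            resT_mul v (hl1 x).le hy1.le, hr1, hr1, ← hl2, ← hl2]
          show (1 - (x : Resk F v)⁻¹) / (1 - (y : Resk F v)⁻¹) = _
          have a1 : (1 - (x : Resk F v)⁻¹) = -((1 - x) / x) := by field_simp; ring
          have a2 : (1 - (y : Resk F v)⁻¹) = -((1 - y) / y) := by field_simp; ring
          rw [a1, a2]
          field_simp)
      have e4 : ∀ n : N, cls (Resk F v) (U (Resk F v) (1 - (x : Resk F v)) (one_sub_ne hx)) • n =
          chiF χ (1 - l x) • n := fun n => hcl _ _ n hx1 (hr1 x).symm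
      have e5 : ∀ n : N, cls (Resk F v) (U (Resk F v) ((x : Resk F v)⁻¹ - 1) (inv_sub_one_ne hx)) • n =
          (chiF χ (l x) * chiF χ (1 - l x)) • n := fun n => by
        rw [hcl _ ((1 - l x) / l x) n (by rw [map_div₀, hx1, hl1, div_one])
          (by
            rw [resT_div v hx1.le (hl1 x), hr1, ← hl2]
            show (x : Resk F v)⁻¹ - 1 = _
            field_simp), H.chi_div, mul_comm]
      simp only [e1, e2, e3, e4, e5, e0]
      exact h)
    crk hcrk hcrk2
  obtain ⟨f', hf'⟩ := loc2_lift (Resk F v) bij f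
  obtain ⟨T, hT⟩ := ind_lift F v (N := N) (by
    intro u n
    rw [hact, hN, hχ']) f'
  have hρ : T.comp σ = ρ := by
    apply rp_ext
    intro x
    rw [LinearMap.comp_apply]
    have hp := pF_unit ρ x
    rcases lt_trichotomy (v (x : F)) 1 with h | h | h
    · rw [hσpos x h, hT, one_smul, hf', hf2, ← hp, hlow _ x.ne_zero h]
    · rw [hσ1 x h, hT, one_smul, hf', hf1, ← hp]
      exact hg _ _ h (resUnit_val v x h)
    · rw [hσneg x h, map_neg, hT, one_smul, hf', hf2, ← hp]
      have h1 := hlow (x : F)⁻¹ (inv_ne_zero x.ne_zero) (by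
        rw [map_inv₀]; exact inv_lt_one_of_one_lt₀ h)
      rw [H.inv _ x.ne_zero] at h1
      rw [← h1, neg_neg]
  intro z hz
  rw [← hρ, LinearMap.comp_apply, hz, map_zero]

end Part7

section Part8
variable {F : Type} [Field F]

theorem ind_tf {Γ₀ : Type} [LinearOrderedCommGroupWithZero Γ₀]
    (v : Valuation F Γ₀) {M : Type} [AddCommGroup M] [Module (RF (Resk F v)) M]
    (hM : Function.Bijective (fun x : M => x + x)) (x : IndMod F v M) (hx : x + x = 0) : x = 0 := by
  letI : Module (ZU F v) (RF F) := Module.compHom _ (zuF F v)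
  letI : Module (ZU F v) M := Module.compHom _ (zuK F v)
  let e : M ≃ₗ[ZU F v] M := LinearEquiv.ofBijective (LinearMap.id + LinearMap.id) hM
  have he : ∀ m, e.symm m + e.symm m = m := fun m => e.apply_symm_apply m
  let h : IndMod F v M →+ IndMod F v M :=
    (LinearMap.lTensor (R := ZU F v) (RF F) (e.symm : M →ₗ[ZU F v] M)).toAddMonoidHom
  have hh : ∀ r m, h (indE F v M r m) = indE F v M r (e.symm m) := fun r m => rfl
  have key : ∀ y : IndMod F v M, h y + h y = y := by
    intro y
    induction y using ind_ind with
    | h0 => rw [map_zero, add_zero]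
    | h1 r m => rw [hh, ← indE_add, he]
    | ha a b ha hb => rw [map_add, add_add_add_comm, ha, hb]
  rw [← key x, ← map_add, hx, map_zero]

theorem surj_final (v : Valuation F (WithZero (Multiplicative ℤ)))
    (crk : RP'K (Resk F v)) (hcrk2 : Nat.card (Resk F v) = 2 → crk ≠ 0)
    (σ : RP' F →ₗ[RF F] IndMod F v (Loc2 (Resk F v) (RP'K (Resk F v))))
    (hσ1 : ∀ (x : Fˣ) (hx : v (x : F) = 1),
      σ (rp F x) = indE F v _ 1 (toLoc2 (Resk F v) (rpK _ (resUnit F v x hx))))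
    (hσpos : ∀ x : Fˣ, v (x : F) < 1 →
      σ (rp F x) = indE F v _ 1 (toLoc2 (Resk F v) crk))
    {ϖ : F} (hϖ0 : ϖ ≠ 0) (hϖ : v ϖ < 1)
    (σ₂ : Loc2 F (RP' F) →ₗ[RF F] IndMod F v (Loc2 (Resk F v) (RP'K (Resk F v))))
    (hσ₂ : ∀ z : RP' F, σ₂ (toLoc2 F z) = σ z) : LinearMap.range σ₂ = ⊤ := by
  rw [eq_top_iff]
  intro x _
  have hmul : ∀ (r : RF (Resk F v)) (m : Loc2 (Resk F v) (RP'K (Resk F v))),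
      indE F v _ 1 m ∈ LinearMap.range σ₂ → indE F v _ 1 (r • m) ∈ LinearMap.range σ₂ := by
    intro r m hm
    induction r using MonoidAlgebra.induction_on with
    | of g =>
      obtain ⟨w, rfl⟩ := sqc_surj g
      obtain ⟨u, rfl⟩ := uvRes_surj v w
      have := indE_smul F v 1 (MonoidAlgebra.of ℤ (Uv F v) u) m
      rw [zuK_single, ← smul_indE] at this
      have h2 : indE F v _ 1 (cls (Resk F v) (uvToResUnits F v u) • m) ∈ LinearMap.range σ₂ := by
        rw [this]; exact Submodule.smul_mem _ _ hm
      exact h2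
    | add a b ha hb => rw [add_smul, indE_add]; exact add_mem ha hb
    | smul n a ha =>
      rw [smul_assoc]
      let φ : Loc2 (Resk F v) (RP'K (Resk F v)) →+ IndMod F v (Loc2 (Resk F v) (RP'K (Resk F v))) :=
        AddMonoidHom.mk' (fun m => indE F v _ 1 m) (fun a b => indE_add F v 1 a b)
      have : φ (n • (a • m)) = n • φ (a • m) := map_zsmul _ _ _
      show φ (n • (a • m)) ∈ _
      rw [this]
      exact zsmul_mem ha n
  have h1 : ∀ z : RP'K (Resk F v), indE F v _ 1 (toLoc2 (Resk F v) z) ∈ LinearMap.range σ₂ := by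
    intro z
    have hz : z ∈ Submodule.span (RF (Resk F v)) (Set.range (rpK (Resk F v)) ∪ {crk}) := by
      rw [span_rpK crk hcrk2]; trivial
    induction hz using Submodule.span_induction with
    | mem y hy =>
      rcases hy with ⟨w, rfl⟩ | hy
      · obtain ⟨a, ha, hw⟩ := res_unit_lift v w
        have h0 : a ≠ 0 := by rintro rfl; simp at ha
        have : resUnit F v (Units.mk0 a h0) ha = w := Units.ext ((resUnit_val v _ ha).trans hw.symm)
        refine ⟨toLoc2 F (rp F (Units.mk0 a h0)), ?_⟩
        rw [hσ₂, hσ1 _ ha, this]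
      · rw [Set.mem_singleton_iff] at hy
        refine ⟨toLoc2 F (rp F (Units.mk0 ϖ hϖ0)), ?_⟩
        rw [hσ₂, hσpos _ hϖ, hy]
    | zero =>
      have := hmul 0 (toLoc2 (Resk F v) crk) ⟨toLoc2 F (rp F (Units.mk0 ϖ hϖ0)), by
        rw [hσ₂, hσpos _ hϖ]⟩
      rw [zero_smul] at this
      rw [← toLoc2L_apply, map_zero]
      exact this
    | add a b _ _ ha hb =>
      rw [← toLoc2L_apply, map_add, indE_add]
      exact add_mem ha hb
    | smul r a _ ha =>
      rw [← toLoc2L_apply, map_smul]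
      exact hmul r _ ha
  have h2 : ∀ m : Loc2 (Resk F v) (RP'K (Resk F v)), indE F v _ 1 (m + m) ∈ LinearMap.range σ₂ →
      indE F v _ 1 m ∈ LinearMap.range σ₂ := by
    rintro m ⟨a, ha⟩
    obtain ⟨b, rfl⟩ := (loc2_bij F).2 a
    refine ⟨b, ?_⟩
    rw [← sub_eq_zero]
    apply ind_tf v (loc2_bij (Resk F v))
    rw [← add_sub_add_comm, ← indE_add, ← ha, map_add, sub_self]
  have h3 : ∀ (j : ℕ) (m : Loc2 (Resk F v) (RP'K (Resk F v))),
      indE F v _ 1 ((2 : RF (Resk F v)) ^ j • m) ∈ LinearMap.range σ₂ →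
      indE F v _ 1 m ∈ LinearMap.range σ₂ := by
    intro j
    induction j with
    | zero => intro m h; rwa [pow_zero, one_smul] at h
    | succ j ih =>
      intro m h
      rw [pow_succ, mul_smul, two_smul] at h
      exact h2 _ (ih _ h)
  induction x using ind_ind with
  | h0 => exact zero_mem _
  | h1 r m =>
    have : indE F v (Loc2 (Resk F v) (RP'K (Resk F v))) r m = r • indE F v _ 1 m := by rw [smul_indE, mul_one]
    rw [this]
    apply Submodule.smul_mem
    obtain ⟨j, z, hz⟩ := loc2_surj (Resk F v) m
    exact h3 j m (hz ▸ h1 z)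
  | ha a b ha hb => exact add_mem (ha trivial) (hb trivial)

theorem v_vzk (v : Valuation F (WithZero (Multiplicative ℤ))) (x : Fˣ) :
    v (x : F) = ((Multiplicative.ofAdd (-vzk F v x) : Multiplicative ℤ) : WithZero (Multiplicative ℤ)) := by
  unfold vzk
  rw [neg_neg, ofAdd_toAdd, WithZero.coe_unzero]

theorem v_lt_iff (v : Valuation F (WithZero (Multiplicative ℤ))) (x y : Fˣ) :
    v (x : F) < v (y : F) ↔ vzk F v y < vzk F v x := by
  rw [v_vzk, v_vzk, WithZero.coe_lt_coe, Multiplicative.ofAdd_lt, neg_lt_neg_iff]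

theorem v_lt_one_iff (v : Valuation F (WithZero (Multiplicative ℤ))) (x : Fˣ) :
    v (x : F) < 1 ↔ 0 < vzk F v x := by
  have h1 : vzk F v 1 = 0 := by
    have := vzk_mul F v 1 1
    rw [one_mul] at this
    omega
  rw [← h1, ← v_lt_iff, Units.val_one, map_one]

theorem exists_unif (v : Valuation F (WithZero (Multiplicative ℤ))) (hsurj : Function.Surjective v) :
    ∃ ϖ : F, ϖ ≠ 0 ∧ v ϖ < 1 ∧ ∀ x, v x < 1 → v x ≤ v ϖ := by
  obtain ⟨ϖ, h⟩ := hsurj ((Multiplicative.ofAdd (-1 : ℤ) : Multiplicative ℤ) : WithZero (Multiplicative ℤ))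
  have h0 : ϖ ≠ 0 := by rintro rfl; rw [map_zero] at h; exact WithZero.coe_ne_zero h.symm
  have h1 : vzk F v (Units.mk0 ϖ h0) = 1 := by
    have := v_vzk v (Units.mk0 ϖ h0)
    rw [Units.val_mk0, h, WithZero.coe_inj] at this
    have := Multiplicative.ofAdd.injective this
    omega
  refine ⟨ϖ, h0, (v_lt_one_iff v (Units.mk0 ϖ h0)).2 (by omega), ?_⟩
  intro x hx
  by_contra! hlt
  have hx0 : x ≠ 0 := by rintro rfl; rw [map_zero] at hlt; exact not_lt_zero hlt
  have a1 := (v_lt_one_iff v (Units.mk0 x hx0)).1 hx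
  have a2 := (v_lt_iff v (Units.mk0 ϖ h0) (Units.mk0 x hx0)).1 hlt
  omega

theorem exists_a (v : Valuation F (WithZero (Multiplicative ℤ)))
    (hU : ∃ n : ℕ, 0 < n ∧ ∀ u ∈ UnV F v n, ∃ w ∈ UnV F v 1, u = w * w)
    (χ : SqCl F →* ℤˣ) (h : ¬ ∀ t, v (t - 1) < 1 → chiF χ t = 1) :
    ∃ a, v a < 1 ∧ chiF χ (1 - a) = -1 ∧ ∀ t, v (t - 1) < v a → chiF χ t = 1 := by
  obtain ⟨n, hn, hsq⟩ := hU
  have tne : ∀ t, v (t - 1) < 1 → t ≠ 0 := by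
    rintro t h rfl
    rw [zero_sub, Valuation.map_neg, map_one] at h
    exact lt_irrefl _ h
  let P : ℕ → Prop := fun m => ∀ u ∈ UnV F v m, χ (sqc F u) = 1
  have hP : ∃ m, P m := ⟨n, fun u hu => by
    obtain ⟨w, _, rfl⟩ := hsq u hu
    rw [sqc_sq, map_one]⟩
  have hP1 : ¬ P 1 := by
    intro hP1
    apply h
    intro t ht
    rw [chiF_of χ (tne t ht), hP1]
    · rfl
    · intro h1
      have := (v_lt_one_iff v (U F (t - 1) h1)).1 ht
      show ((1 : ℕ) : ℤ) ≤ vzk F v (U F (t - 1) h1)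
      push_cast
      omega
  have hP0 : ¬ P 0 := by
    intro hP0
    apply hP1
    intro u hu
    refine hP0 u fun h => le_trans ?_ (hu h)
    norm_num
  obtain ⟨m, hm⟩ : ∃ m, Nat.find hP = m + 2 := by
    have h0 : Nat.find hP ≠ 0 := fun e => hP0 (e ▸ Nat.find_spec hP)
    have h1 : Nat.find hP ≠ 1 := fun e => hP1 (e ▸ Nat.find_spec hP)
    exact ⟨Nat.find hP - 2, by omega⟩
  have hs : P (m + 2) := hm ▸ Nat.find_spec hP
  have hns : ¬ P (m + 1) := Nat.find_min hP (by omega)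
  obtain ⟨q, hq, hq1⟩ : ∃ q, q ∈ UnV F v (m + 1) ∧ χ (sqc F q) ≠ 1 := by
    by_contra! hh
    exact hns hh
  have hqm : χ (sqc F q) = -1 := (Int.units_eq_one_or _).resolve_left hq1
  have hne : (q : F) - 1 ≠ 0 := by
    intro e
    apply hq1
    have : q = 1 := Units.ext (sub_eq_zero.1 e)
    rw [this, map_one, map_one]
  have hva : v (1 - (q : F)) = v ((U F ((q : F) - 1) hne : Fˣ) : F) := by
    rw [Valuation.map_sub_swap]; rfl
  have hge := hq hne
  have hlt : v (1 - (q : F)) < 1 := by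
    rw [hva, v_lt_one_iff]
    push_cast at hge
    omega
  refine ⟨1 - (q : F), hlt, ?_, ?_⟩
  · rw [sub_sub_cancel, chiF_unit, hqm]; rfl
  · intro t ht
    rw [chiF_of χ (tne t (ht.trans hlt)), hs]
    · rfl
    · intro h1
      rw [hva] at ht
      have := (v_lt_iff v (U F (t - 1) h1) _).1 ht
      show ((m + 2 : ℕ) : ℤ) ≤ vzk F v (U F (t - 1) h1)
      push_cast at hge ⊢
      omega

end Part8

/-- Let `F` be a field with at least `4` elements and `v : F^× → ℤ` a
surjective discrete valuation with residue field `k`.  Suppose `U_n ⊆ U_1²` for some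
`n > 0`, where `U_m = 1 + M_v^m`.  Then the specialization homomorphism `σ` (from
`RP′(F)` to `Ind_F^k RP′(k)[1/2]`, determined on generators by `[x] ↦ 1 ⊗ [x̄]` if
`v(x) = 0`, `[x] ↦ 1 ⊗ C_k` if `v(x) > 0`, `[x] ↦ -(1 ⊗ C_k)` if `v(x) < 0`) induces
an isomorphism of `R_F`-modules `I_F·RP′(F)[1/2] ≅ I_F·(Ind_F^k RP′(k)[1/2])`:  the
induced map `σ₂` on `RP′(F)[1/2]` carries `I_F·RP′(F)[1/2]` onto
`I_F·(Ind_F^k RP′(k)[1/2])` and is injective on it. -/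
theorem statement11 (F : Type) [Field F] (hcard : 4 ≤ Cardinal.mk F)
    (v : Valuation F (WithZero (Multiplicative ℤ))) (hsurj : Function.Surjective v)
    (hU : ∃ n : ℕ, 0 < n ∧ ∀ u ∈ UnV F v n, ∃ w ∈ UnV F v 1, u = w * w)
    (crk : RP'K (Resk F v))
    (hcrk : ∀ (u : (Resk F v)ˣ) (hu : (u : Resk F v) ≠ 1),
      crk = rpK _ u + rpK _ (U (Resk F v) (1 - (u : Resk F v)) (one_sub_ne hu)))
    (hcrk2 : Nat.card (Resk F v) = 2 → crk ≠ 0)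
    (σ : RP' F →ₗ[RF F] IndMod F v (Loc2 (Resk F v) (RP'K (Resk F v))))
    (hσ1 : ∀ (x : Fˣ) (hx : v (x : F) = 1),
      σ (rp F x) = indE F v _ 1 (toLoc2 (Resk F v) (rpK _ (resUnit F v x hx))))
    (hσpos : ∀ x : Fˣ, v (x : F) < 1 →
      σ (rp F x) = indE F v _ 1 (toLoc2 (Resk F v) crk))
    (hσneg : ∀ x : Fˣ, 1 < v (x : F) →
      σ (rp F x) = -indE F v _ 1 (toLoc2 (Resk F v) crk))
    (σ₂ : Loc2 F (RP' F) →ₗ[RF F] IndMod F v (Loc2 (Resk F v) (RP'K (Resk F v))))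
    (hσ₂ : ∀ z : RP' F, σ₂ (toLoc2 F z) = σ z) :
    Submodule.map σ₂
        (augIdeal F • (⊤ : Submodule (RF F) (Loc2 F (RP' F)))) =
      augIdeal F •
        (⊤ : Submodule (RF F) (IndMod F v (Loc2 (Resk F v) (RP'K (Resk F v))))) ∧
    ∀ m ∈ augIdeal F • (⊤ : Submodule (RF F) (Loc2 F (RP' F))), σ₂ m = 0 → m = 0 := by
  obtain ⟨ϖ, hϖ0, hϖ, hu⟩ := exists_unif v hsurj
  have hsur := surj_final v crk hcrk2 σ hσ1 hσpos hϖ0 hϖ σ₂ hσ₂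
  refine ⟨by rw [Submodule.map_smul'', Submodule.map_top, hsur], ?_⟩
  intro m hm hσm
  by_contra hm0
  have hM := loc2_bij F (M := RP' F)
  obtain ⟨χ, hχ⟩ := exists_chi (F := F) (Loc2 F (RP' F)) (by
    intro x hx
    rw [two_smul] at hx
    exact hM.1 (hx.trans (add_zero _).symm)) m hm0
  have h1 : χ ≠ 1 := by
    rintro rfl
    exact hχ (aug_le_chiSub _ hm)
  have bij := chi_bij χ hM
  have tf : ∀ n : ChiQuot F χ (Loc2 F (RP' F)), n + n = 0 → n = 0 := fun n hn =>
    bij.1 (hn.trans (add_zero _).symm)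
  have hN := chi_act χ (M := Loc2 F (RP' F))
  let ρ : RP' F →ₗ[RF F] ChiQuot F χ (Loc2 F (RP' F)) := (mkChiL χ).comp (toLoc2L F)
  suffices hz : ∀ z, σ z = 0 → ρ z = 0 by
    obtain ⟨j, z, hj⟩ := loc2_surj F m
    have hρ : mkChiL χ ((2 : RF F) ^ j • m) = 0 := by
      rw [hj]
      apply hz
      rw [← hσ₂, ← hj, map_smul, hσm, smul_zero]
    rw [map_smul] at hρ
    apply hχ
    rw [← mkChiL_eq_zero]
    clear hj
    revert hρ
    generalize mkChiL χ m = y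
    induction j with
    | zero => intro h; rwa [pow_zero, one_smul] at h
    | succ j ih =>
      intro h
      apply ih
      rw [pow_succ', mul_smul, two_smul] at h
      exact tf _ h
  by_cases hm1 : χ (sqc F (-1)) = 1
  · have H := mkCore ρ χ hN tf h1 hm1
    have hϖ1 : ϖ ≠ 1 := by rintro rfl; simp at hϖ
    have hC : Core.IsC (pF ρ) (pF ρ ϖ + pF ρ (1 - ϖ)) := fun x hx hx1 => H.const hx hx1 hϖ0 hϖ1
    by_cases ht : ∀ t, v (t - 1) < 1 → chiF χ t = 1
    · exact caseB_final v bij ρ χ hN H hC (H.three hϖ0 hϖ1) hϖ0 hϖ hu ht crk hcrk hcrk2 σ hσ1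
        hσpos hσneg
    · obtain ⟨a, ha1, ha2, ha3⟩ := exists_a v hU χ ht
      have h0 := H.caseA hC v ha1 ha2 ha3
      have : ρ = 0 := rp_ext _ _ fun x => by
        rw [← pF_unit, h0 _ x.ne_zero]; rfl
      intro z _
      rw [this]; rfl
  · have hm1' : χ (sqc F (-1)) = -1 := (Int.units_eq_one_or _).resolve_left hm1
    have : ρ = 0 := rp_ext _ _ fun x => by
      have h := congrArg ρ (rp_minus x)
      rw [map_sub, map_smul, hN, hm1', map_zero] at h
      apply tf
      have h2 : ((-1 : ℤˣ) : ℤ) • ρ (rp F x) = - ρ (rp F x) := by simp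
      rw [h2, ← neg_add', neg_eq_zero] at h
      exact h
    intro z _
    rw [this]; rfl
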